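/- arXiv:2104.10198 — 3 statements merged into one kernel-verified Lean document; each statement's English description precedes it below -/
import Mathlib

section
/- Let k be a field, V a finite-dimensional k-vector space, and f̄ = (f_1,…,f_s) a collection of homogeneous polynomials of degree d on V defining a complete intersection, i.e., the subscheme V(f̄) ⊂ V cut out by the ideal (f_1,…,f_s) has codimension s in V. Then c'(f̄) ≤ c(f̄) ≤ c'(f̄) + s. If moreover char(k) does not divide d−1, then c'(f̄) ≤ g_sym(f̄). -/
open MvPolynomial

/-- Krull dimension of the closed subscheme of affine space cut out by an ideal of the
polynomial ring. -/
noncomputable def affineDim {σ : Type} [Fintype σ] (k : Type) [Field k]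
    (I : Ideal (MvPolynomial σ k)) : WithBot ℕ∞ :=
  ringKrullDim (MvPolynomial σ k ⧸ I)

/-- Codimension (inside the affine space of dimension `card σ`) of the closed subscheme of
affine space cut out by an ideal; the empty scheme has codimension `⊤`. -/
noncomputable def affineCodim {σ : Type} [Fintype σ] (k : Type) [Field k]
    (I : Ideal (MvPolynomial σ k)) : ℕ∞ :=
  WithBot.recBotCoe ⊤ (fun dm => (Fintype.card σ : ℕ∞) - dm) (affineDim k I)

/-- The ideal of `Z^sym_{f̄} ⊆ V × V` for a collection `f̄ = (f 1, …, f s)`: in the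
coordinates `(v, x)` (with `v` the `Sum.inl` variables and `x` the `Sum.inr` variables) it is
generated by the `s × s` minors of the `s × n` matrix whose `(i, l)` entry is
`H_{f i}(x)(e_l, v) = ∑ j, v j * (∂_l ∂_j (f i))(x)`; its zero locus is the set of `(v, x)`
where the linear map `v' ↦ (H_{f i}(x)(v', v))_i` has rank `< s`. -/
noncomputable def zSymFamIdeal {k : Type} [Field k] {n s : ℕ}
    (f : Fin s → MvPolynomial (Fin n) k) : Ideal (MvPolynomial (Fin n ⊕ Fin n) k) :=
  Ideal.span (Set.range fun c : Fin s → Fin n =>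
    Matrix.det (Matrix.of fun i i' : Fin s =>
      ∑ j : Fin n, X (Sum.inl j) * rename Sum.inr (pderiv (c i') (pderiv j (f i)))))

/-- The ideal of the locus `S(f̄)` where the Jacobian matrix of `(f 1, …, f s)` has rank
`< s`: it is generated by all `s × s` minors of the Jacobian matrix. -/
noncomputable def jacIdeal {k : Type} [Field k] {n s : ℕ}
    (f : Fin s → MvPolynomial (Fin n) k) : Ideal (MvPolynomial (Fin n) k) :=
  Ideal.span (Set.range fun c : Fin s → Fin n =>
    Matrix.det (Matrix.of fun i j : Fin s => pderiv (c j) (f i)))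

namespace MvPolynomial

theorem height_eq_of_isMaximal {k : Type*} [Field k] (n : ℕ)
    (M : Ideal (MvPolynomial (Fin n) k)) [hM : M.IsMaximal] : M.height = n := by
  induction n with
  | zero =>
    have h := Ideal.height_le_ringKrullDim_of_ne_top hM.ne_top
    simpa using h
  | succ n ih =>
    let e := (finSuccEquiv k n).toRingEquiv
    let N := M.map e
    have hN : N.IsMaximal := Ideal.map_isMaximal_of_equiv e
    have : (N.under (MvPolynomial (Fin n) k)).IsMaximal :=
      Polynomial.isMaximal_comap_C_of_isJacobsonRing N
    have : N.LiesOver (N.under (MvPolynomial (Fin n) k)) := ⟨rfl⟩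
    rw [← e.height_map M, Polynomial.height_eq_height_add_one (N.under (MvPolynomial (Fin n) k)) N, ih]
    simp

theorem pderiv_comm {σ R : Type*} [CommRing R] (i j : σ) (p : MvPolynomial σ R) :
    pderiv i (pderiv j p) = pderiv j (pderiv i p) := by
  classical
  have h : ⁅(pderiv i : Derivation R (MvPolynomial σ R) (MvPolynomial σ R)),
      (pderiv j : Derivation R (MvPolynomial σ R) (MvPolynomial σ R))⁆ = 0 := by
    refine derivation_ext fun l => ?_
    simp [Derivation.commutator_apply, pderiv_X, Pi.single_apply, apply_ite]
  have := congrArg (fun D => D p) h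
  simpa [Derivation.commutator_apply, sub_eq_zero] using this

theorem isHomogeneous_det {σ R : Type*} [CommRing R] {s e : ℕ}
    (M : Matrix (Fin s) (Fin s) (MvPolynomial σ R)) (h : ∀ i j, (M i j).IsHomogeneous e) :
    M.det.IsHomogeneous (s * e) := by
  rw [Matrix.det_apply]
  refine IsHomogeneous.sum _ _ _ fun τ _ => ?_
  have hp : (∏ i, M (τ i) i).IsHomogeneous (s * e) := by
    simpa using IsHomogeneous.prod Finset.univ (fun i => M (τ i) i) (fun _ => e)
      fun i _ => h (τ i) i
  rcases Int.units_eq_one_or (Equiv.Perm.sign τ) with hs | hs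
  · simpa [hs] using hp
  · simpa [hs] using hp.neg

end MvPolynomial

/-- In a finitely generated domain over a field, every maximal ideal has full height. -/
theorem ringKrullDim_le_height_of_isMaximal (k : Type*) {B : Type*} [Field k] [CommRing B]
    [IsDomain B] [Algebra k B] [Algebra.FiniteType k B] (M : Ideal B) [M.IsMaximal] :
    ringKrullDim B ≤ M.height := by
  obtain ⟨e, g, hinj, hint⟩ := exists_integral_inj_algHom_of_fg k B
  algebraize [g.toRingHom]
  have : FaithfulSMul (MvPolynomial (Fin e) k) B :=
    (faithfulSMul_iff_algebraMap_injective _ _).mpr hinj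
  have : IsNoetherianRing B := Algebra.FiniteType.isNoetherianRing k B
  have hdim : ringKrullDim B ≤ ringKrullDim (MvPolynomial (Fin e) k) :=
    Order.krullDim_le_of_strictMono
      (PrimeSpectrum.comap (algebraMap (MvPolynomial (Fin e) k) B))
      fun P Q hPQ => Ideal.IsIntegral.comap_lt_comap (I := P.asIdeal) (J := Q.asIdeal) hPQ
  have : (M.under (MvPolynomial (Fin e) k)).IsMaximal :=
    Ideal.isMaximal_comap_of_isIntegral_of_isMaximal M
  have hht := Ideal.height_eq_height_add_of_liesOver_of_hasGoingDown
    (M.under (MvPolynomial (Fin e) k)) M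
  rw [MvPolynomial.height_eq_of_isMaximal] at hht
  refine hdim.trans ?_
  simp only [MvPolynomial.ringKrullDim_of_isNoetherianRing, ringKrullDim_eq_zero_of_field,
    Nat.card_fin, zero_add]
  rw [hht]
  exact_mod_cast le_self_add

/-- Every prime containing homogeneous elements contains a prime which contains these elements
and is contained in the ideal of the origin. -/
theorem exists_isPrime_le_ker_constantCoeff {σ k : Type*} [Field k]
    {S : Set (MvPolynomial σ k)}
    (hS : ∀ p ∈ S, ∃ e, p.IsHomogeneous e) (P : Ideal (MvPolynomial σ k)) [hP : P.IsPrime]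
    (hSP : S ⊆ P) :
    ∃ Q : Ideal (MvPolynomial σ k), Q.IsPrime ∧ S ⊆ Q ∧ Q ≤ P ∧
      Q ≤ RingHom.ker (constantCoeff (σ := σ) (R := k)) := by
  let := gradedAlgebra (σ := σ) (R := k)
  refine ⟨(P.homogeneousCore (homogeneousSubmodule σ k)).toIdeal, hP.homogeneousCore,
    fun p hp => ?_, Ideal.toIdeal_homogeneousCore_le _ _, fun p hp => ?_⟩
  · obtain ⟨e, he⟩ := hS p hp
    exact Ideal.mem_homogeneousCore_of_homogeneous_of_mem ⟨e, he⟩ (hSP hp)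
  · have h0 := homogeneousComponent_mem_of_mem
      (P.homogeneousCore (homogeneousSubmodule σ k)).isHomogeneous hp 0
    rw [homogeneousComponent_zero] at h0
    by_contra hne
    exact hP.ne_top (Ideal.eq_top_of_isUnit_mem _ (Ideal.toIdeal_homogeneousCore_le _ _ h0)
      ((isUnit_iff_ne_zero.mpr hne).map C))

section Homogeneous

variable {σ k : Type*} [Finite σ] [Field k]

/-- Cutting a homogeneous prime by `m` equations through the origin drops the dimension by at
most `m`. -/
theorem ringKrullDim_quotient_prime_le_add {m : ℕ} (P : Ideal (MvPolynomial σ k)) [P.IsPrime]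
    (hP : P ≤ RingHom.ker (constantCoeff (σ := σ) (R := k)))
    (g : Fin m → MvPolynomial σ k) (hg : ∀ i, constantCoeff (g i) = 0) :
    ringKrullDim (MvPolynomial σ k ⧸ P) ≤
      ringKrullDim (MvPolynomial σ k ⧸ (P ⊔ Ideal.span (Set.range g))) + m := by
  have : (RingHom.ker (constantCoeff (σ := σ) (R := k))).IsMaximal :=
    RingHom.ker_isMaximal_of_surjective _ fun a => ⟨C a, constantCoeff_C σ a⟩
  let M := (RingHom.ker (constantCoeff (σ := σ) (R := k))).map (Ideal.Quotient.mk P)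
  have hM : M.IsMaximal := by
    refine .map_of_surjective_of_ker_le Ideal.Quotient.mk_surjective ?_
    rwa [Ideal.mk_ker]
  let S := Set.range fun i => Ideal.Quotient.mk P (g i)
  have hS : S ⊆ M := by
    rintro _ ⟨i, rfl⟩
    exact Ideal.mem_map_of_mem _ (hg i)
  have hcard : S.encard ≤ m := by
    simpa [S, Set.image_univ] using
      Set.encard_image_le (fun i => Ideal.Quotient.mk P (g i)) Set.univ
  refine (ringKrullDim_le_height_of_isMaximal k M).trans
    ((Ideal.height_le_ringKrullDim_quotient_add_encard S hS).trans ?_)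
  refine add_le_add ?_ (by exact_mod_cast hcard)
  let φ := (Ideal.Quotient.mk (Ideal.span S)).comp (Ideal.Quotient.mk P)
  have hφ : ∀ a ∈ P ⊔ Ideal.span (Set.range g), φ a = 0 := by
    suffices P ⊔ Ideal.span (Set.range g) ≤ RingHom.ker φ from fun a ha => this ha
    refine sup_le (fun a ha => ?_) (Ideal.span_le.mpr ?_)
    · simp [φ, RingHom.mem_ker, Ideal.Quotient.eq_zero_iff_mem.mpr ha]
    · rintro _ ⟨i, rfl⟩
      exact Ideal.Quotient.eq_zero_iff_mem.mpr (Ideal.subset_span ⟨i, rfl⟩)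
  exact ringKrullDim_le_of_surjective (Ideal.Quotient.lift _ φ hφ)
    (Ideal.Quotient.lift_surjective_of_surjective _ _
      (Ideal.Quotient.mk_surjective.comp Ideal.Quotient.mk_surjective))

/-- Cutting a cone by `m` equations through the origin drops the dimension by at most `m`. -/
theorem ringKrullDim_quotient_span_le_add {m : ℕ} {S : Set (MvPolynomial σ k)}
    (hS : ∀ p ∈ S, ∃ e, p.IsHomogeneous e)
    (g : Fin m → MvPolynomial σ k) (hg : ∀ i, constantCoeff (g i) = 0) :
    ringKrullDim (MvPolynomial σ k ⧸ Ideal.span S) ≤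
      ringKrullDim (MvPolynomial σ k ⧸ (Ideal.span S ⊔ Ideal.span (Set.range g))) + m := by
  rw [ringKrullDim_quotient (Ideal.span S)]
  refine iSup_le fun l => ?_
  have hl : S ⊆ l.head.1.asIdeal := Ideal.span_le.mp l.head.2
  obtain ⟨Q, hQ, hSQ, hQl, hQ0⟩ := exists_isPrime_le_ker_constantCoeff hS l.head.1.asIdeal hl
  have hSQ' : Ideal.span S ≤ Q := Ideal.span_le.mpr hSQ
  have hlen : (l.length : WithBot ℕ∞) ≤ ringKrullDim (MvPolynomial σ k ⧸ Q) := by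
    rw [ringKrullDim_quotient]
    let l' : LTSeries (PrimeSpectrum.zeroLocus (Q : Set (MvPolynomial σ k))) :=
      { length := l.length
        toFun := fun i => ⟨(l i).1, hQl.trans (l.head_le i)⟩
        step := l.step }
    exact Order.LTSeries.length_le_krullDim l'
  refine hlen.trans ((ringKrullDim_quotient_prime_le_add Q hQ0 g hg).trans ?_)
  gcongr
  exact ringKrullDim_le_of_surjective (Ideal.Quotient.factor (sup_le_sup_right hSQ' _))
    (Ideal.Quotient.factor_surjective _)

end Homogeneous

/-- The codimension of a scheme of dimension `a` in an ambient space of dimension `N`. -/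
noncomputable def codimOfDim (N : ℕ∞) (a : WithBot ℕ∞) : ℕ∞ :=
  WithBot.recBotCoe ⊤ (fun dm => N - dm) a

@[simp] theorem codimOfDim_bot (N : ℕ∞) : codimOfDim N ⊥ = ⊤ := rfl

@[simp] theorem codimOfDim_coe (N a : ℕ∞) : codimOfDim N a = N - a := rfl

theorem codim_le_codim_add {N : ℕ∞} {s : ℕ} {a b : WithBot ℕ∞} (h : a ≤ b + s) :
    codimOfDim N b ≤
      codimOfDim N a + s := by
  induction a with
  | bot => simp
  | coe a =>
    induction b with
    | bot => simp at h
    | coe b =>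
      have h' : a ≤ b + s := by exact_mod_cast h
      simp only [codimOfDim_coe]
      rw [tsub_le_iff_right, add_assoc, add_comm (s : ℕ∞) b]
      exact le_tsub_add.trans (by gcongr)

theorem codim_le_codim_of_le {N : ℕ∞} {a b : WithBot ℕ∞} (h : a ≤ b) :
    codimOfDim N b ≤
      codimOfDim N a := by
  simpa using codim_le_codim_add (N := N) (s := 0) (a := a) (b := b) (by simpa using h)

theorem codim_le_codim_add_ambient {N : ℕ∞} {s : ℕ} {a b : WithBot ℕ∞} (h : a ≤ b + s) :
    codimOfDim N b ≤
      codimOfDim (N + s) a := by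
  induction a with
  | bot => simp
  | coe a =>
    induction b with
    | bot => simp at h
    | coe b =>
      have h' : a ≤ b + s := by exact_mod_cast h
      simp only [codimOfDim_coe]
      calc N - b = N + s - (b + s) := by
            rw [add_comm b, ← tsub_tsub, ENat.addLECancellable_natCast s |>.add_tsub_cancel_right]
        _ ≤ _ := tsub_le_tsub_left h' _

theorem constantCoeff_eq_zero_of_isHomogeneous {σ k : Type*} [Field k] {d : ℕ}
    {p : MvPolynomial σ k} (hp : p.IsHomogeneous d) (hu : ¬ IsUnit p) :
    constantCoeff p = 0 := by
  by_contra hne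
  have hd : d = 0 := by
    by_contra hd
    exact hne (hp.coeff_eq_zero (d := 0) (by simpa using Ne.symm hd))
  subst hd
  rw [← totalDegree_zero_iff_isHomogeneous, totalDegree_eq_zero_iff_eq_C] at hp
  exact hu (hp ▸ (isUnit_iff_ne_zero.mpr hne).map C)

/-- Restricting `Z^sym` to the diagonal of `V × V` gives a subscheme of `S(f̄)`. -/
theorem ringKrullDim_diagonal_le {k : Type} [Field k] {n d s : ℕ}
    (f : Fin s → MvPolynomial (Fin n) k) (hhom : ∀ i, (f i).IsHomogeneous d)
    (hd : ((d - 1 : ℕ) : k) ≠ 0) :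
    ringKrullDim (MvPolynomial (Fin n ⊕ Fin n) k ⧸ (zSymFamIdeal f ⊔
      Ideal.span (Set.range fun j : Fin n => X (Sum.inl j) - X (Sum.inr j)))) ≤
    ringKrullDim (MvPolynomial (Fin n) k ⧸ jacIdeal f) := by
  set K := zSymFamIdeal f ⊔
    Ideal.span (Set.range fun j : Fin n =>
      (X (Sum.inl j) - X (Sum.inr j) : MvPolynomial (Fin n ⊕ Fin n) k)) with hK
  let q := Ideal.Quotient.mk K
  let φ : MvPolynomial (Fin n) k →+* MvPolynomial (Fin n ⊕ Fin n) k ⧸ K :=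
    q.comp (rename (R := k) Sum.inr).toRingHom
  have hφ_apply : ∀ p, φ p = q (rename Sum.inr p) := fun _ => rfl
  have hX : ∀ j, q (X (Sum.inl j)) = q (X (Sum.inr j)) := fun j =>
    Ideal.Quotient.eq.mpr (Ideal.mem_sup_right (Ideal.subset_span ⟨j, rfl⟩))
  have hsurj : Function.Surjective φ := by
    intro y
    obtain ⟨p, rfl⟩ := Ideal.Quotient.mk_surjective y
    refine ⟨aeval (Sum.elim X X) p, ?_⟩
    have : (φ.comp (aeval (Sum.elim X X)).toRingHom) = q := by
      refine ringHom_ext (fun a => ?_) ?_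
      · simp [φ, q]
      · rintro (j | j)
        · simp [hφ_apply, hX]
        · simp [hφ_apply]
    exact congrArg (fun ψ => ψ p) this
  have hker : ∀ a ∈ jacIdeal f, φ a = 0 := by
    suffices jacIdeal f ≤ RingHom.ker φ from fun a ha => this ha
    refine Ideal.span_le.mpr ?_
    rintro _ ⟨c, rfl⟩
    have hz : q (Matrix.det (Matrix.of fun i i' : Fin s =>
        ∑ j : Fin n, X (Sum.inl j) * rename Sum.inr (pderiv (c i') (pderiv j (f i))))) = 0 :=
      Ideal.Quotient.eq_zero_iff_mem.mpr (Ideal.mem_sup_left (Ideal.subset_span ⟨c, rfl⟩))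
    have hmat : q.mapMatrix (Matrix.of fun i i' : Fin s =>
        ∑ j : Fin n, X (Sum.inl j) * rename Sum.inr (pderiv (c i') (pderiv j (f i)))) =
        φ (C ((d - 1 : ℕ) : k)) •
          φ.mapMatrix (Matrix.of fun i j : Fin s => pderiv (c j) (f i)) := by
      ext i i'
      have hEuler := (hhom i).pderiv (i := c i') |>.sum_X_mul_pderiv
      have := congrArg φ hEuler
      simp only [map_sum, map_mul, nsmul_eq_mul] at this
      simp only [RingHom.mapMatrix_apply, Matrix.map_apply, Matrix.of_apply, map_sum, map_mul,
        Matrix.smul_apply, smul_eq_mul, hX]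
      simp only [map_natCast] at this ⊢
      rw [← this]
      refine Finset.sum_congr rfl fun j _ => ?_
      rw [pderiv_comm (c i') j]
      simp [hφ_apply]
    rw [RingHom.map_det, hmat, Matrix.det_smul, ← RingHom.map_det] at hz
    have hunit : IsUnit (φ (C ((d - 1 : ℕ) : k))) :=
      ((isUnit_iff_ne_zero.mpr hd).map C).map φ
    exact (hunit.pow _).mul_right_eq_zero.mp hz
  exact ringKrullDim_le_of_surjective (Ideal.Quotient.lift _ φ hker)
    (Ideal.Quotient.lift_surjective_of_surjective _ _ hsurj)

/-- Proposition 3.3(iii). Let `f̄ = (f 1, …, f s)` be homogeneous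
polynomials of degree `d` on `V` defining a complete intersection (the subscheme `V(f̄)` cut
out by the ideal `(f 1, …, f s)` has codimension `s`).  Then `c'(f̄) ≤ c(f̄) ≤ c'(f̄) + s`,
where `c(f̄)` is the codimension in `V` of the singular locus of `V(f̄)` (for the complete
intersection `V(f̄)` this singular locus is cut out by `f̄` together with the `s × s` minors
of its Jacobian matrix, i.e. `Sing(V(f̄)) = V(f̄) ∩ S(f̄)`) and `c'(f̄)` is the codimension
of `S(f̄)`.  If moreover `char k` does not divide `d - 1`, then `c'(f̄) ≤ g_sym(f̄)`. -/
theorem c'_le_c_le_c'_add_s {k : Type} [Field k] {n d s : ℕ}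
    (f : Fin s → MvPolynomial (Fin n) k) (hhom : ∀ i, (f i).IsHomogeneous d)
    (hCI : affineCodim k (Ideal.span (Set.range f)) = (s : ℕ∞)) :
    affineCodim k (jacIdeal f) ≤ affineCodim k (Ideal.span (Set.range f) ⊔ jacIdeal f) ∧
      affineCodim k (Ideal.span (Set.range f) ⊔ jacIdeal f) ≤
        affineCodim k (jacIdeal f) + (s : ℕ∞) ∧
      (¬ (ringChar k ∣ d - 1) →
        affineCodim k (jacIdeal f) ≤ affineCodim k (zSymFamIdeal f)) := by
  refine ⟨?_, ?_, fun hchar => ?_⟩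
  · exact codim_le_codim_of_le (ringKrullDim_le_of_surjective
      (Ideal.Quotient.factor le_sup_right) (Ideal.Quotient.factor_surjective _))
  · have hne : Ideal.span (Set.range f) ≠ ⊤ := by
      intro h
      have : Subsingleton (MvPolynomial (Fin n) k ⧸ Ideal.span (Set.range f)) :=
        Ideal.Quotient.subsingleton_iff.mpr h
      simp [affineCodim, affineDim, ringKrullDim_eq_bot_of_subsingleton] at hCI
    have hf : ∀ i, constantCoeff (f i) = 0 := fun i =>
      constantCoeff_eq_zero_of_isHomogeneous (hhom i) fun hu =>
        hne (Ideal.eq_top_of_isUnit_mem _ (Ideal.subset_span ⟨i, rfl⟩) hu)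
    refine codim_le_codim_add ?_
    rw [sup_comm]
    refine ringKrullDim_quotient_span_le_add ?_ f hf
    rintro _ ⟨c, rfl⟩
    exact ⟨_, isHomogeneous_det _ fun i j => (hhom i).pderiv⟩
  · have hd : ((d - 1 : ℕ) : k) ≠ 0 := fun h => hchar ((ringChar.spec k _).mp h)
    have key := ringKrullDim_quotient_span_le_add (σ := Fin n ⊕ Fin n) (k := k)
      (S := Set.range fun c : Fin s → Fin n => Matrix.det (Matrix.of fun i i' : Fin s =>
        ∑ j : Fin n, X (Sum.inl j) * rename Sum.inr (pderiv (c i') (pderiv j (f i)))))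
      (by
        rintro _ ⟨c, rfl⟩
        refine ⟨_, isHomogeneous_det (e := 1 + (d - 1 - 1)) _ fun i i' => ?_⟩
        exact IsHomogeneous.sum Finset.univ (fun j => X (Sum.inl j) *
          rename Sum.inr (pderiv (c i') (pderiv j (f i)))) _ fun j _ =>
            (isHomogeneous_X k _).mul (hhom i).pderiv.pderiv.rename_isHomogeneous)
      (fun j : Fin n => X (Sum.inl j) - X (Sum.inr j)) (fun j => by simp)
    have := codim_le_codim_add_ambient (N := n)
      (key.trans (add_le_add_left (ringKrullDim_diagonal_le f hhom hd) _))
    have hcard : ((Fintype.card (Fin n ⊕ Fin n) : ℕ) : ℕ∞) = n + n := by simp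
    change codimOfDim (Fintype.card (Fin n)) _ ≤ codimOfDim (Fintype.card (Fin n ⊕ Fin n)) _
    rw [hcard, Fintype.card_fin]
    exact this
end

section
/- Let k be an algebraically closed field whose characteristic does not divide d(d−1), with d ≥ 3, V a finite-dimensional k-vector space, and f a nonzero homogeneous polynomial of degree d on V. Then (1/2)·c(f) ≤ rk^S(f) ≤ 2^{d−3}·(d+1)·c(f); moreover, if d is odd, then rk^S(f) ≤ 2^{d−3}·d·c(f). -/
open MvPolynomial

/-- The Schmidt rank (strength) of a polynomial: the smallest `r` such that
`f = ∑ i : Fin r, g i * h i` with all `g i`, `h i` homogeneous of positive degree. -/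
noncomputable def polySchmidtRank {k : Type} [Field k] {σ : Type} (f : MvPolynomial σ k) : ℕ :=
  sInf {r | ∃ g h : Fin r → MvPolynomial σ k,
    (∀ i, ∃ a, 0 < a ∧ (g i).IsHomogeneous a) ∧
    (∀ i, ∃ b, 0 < b ∧ (h i).IsHomogeneous b) ∧
    f = ∑ i, g i * h i}

/-- The ideal of the singular locus of the hypersurface `f = 0`: it is generated by `f`
together with all first partial derivatives of `f`. -/
noncomputable def singIdeal {k : Type} [Field k] {n : ℕ} (f : MvPolynomial (Fin n) k) :
    Ideal (MvPolynomial (Fin n) k) :=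
  Ideal.span ({f} ∪ Set.range fun i => pderiv i f)

open IntermediateField in
/-- Over a perfect field, a finite set generating a field extension contains a separating
transcendence basis. -/
theorem exists_isTranscendenceBasis_subset_isSeparable {k K : Type*} [Field k] [Field K]
    [Algebra k K] [PerfectField k] {S : Set K} (hfin : S.Finite) (hS : adjoin k S = ⊤) :
    ∃ t ⊆ S, IsTranscendenceBasis k ((↑) : t → K) ∧ Algebra.IsSeparable (adjoin k t) K := by
  have : Algebra.EssFiniteType k K :=
    fg_top_iff.mp ⟨hfin.toFinset, by simpa using hS⟩
  have : Algebra.IsAlgebraic (Algebra.adjoin k S) K := by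
    rw [← isAlgebraic_adjoin_iff_top, hS, Algebra.isAlgebraic_iff_isIntegral]
    exact Algebra.isIntegral_of_surjective topEquiv.surjective
  let d (t : Set K) := Field.finInsepDegree (adjoin k t) K
  have hne : {t : Set K | t ⊆ S ∧ IsTranscendenceBasis k ((↑) : t → K)}.Nonempty :=
    exists_isTranscendenceBasis_subset S
  let s := d.argminOn _ hne
  obtain ⟨hsS, hs⟩ := d.argminOn_mem _ hne
  have hfs : Module.Finite (adjoin k s) K := by
    apply +allowSynthFailures Algebra.finite_of_essFiniteType_of_isAlgebraic
    · exact .of_comp k _ _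
    · convert! hs.isAlgebraic_field <;> simp [s]
  have halg : Algebra.IsAlgebraic (adjoin k s) K := inferInstance
  refine ⟨s, hsS, hs, ?_⟩
  obtain _ | ⟨p, hp, hpk⟩ := CharP.exists' k
  · infer_instance
  have : ExpChar k p := .prime hp.out
  have : CharP K p := .of_ringHom_of_ne_zero (algebraMap k K) p hp.out.ne_zero
  have H (u : Finset K) (hu : LinearIndepOn k _root_.id (u : Set K)) :
      LinearIndepOn k (· ^ p) (u : Set K) := by
    refine hu.map_of_injective_injective (frobeniusEquiv k p).symm
      (frobenius K p).toAddMonoidHom (by simp) (by simp) fun r m ↦ ?_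
    have hr : (frobeniusEquiv k p).symm r ^ p = r := frobeniusEquiv_symm_pow_p k p r
    change ((frobeniusEquiv k p).symm r • m) ^ p = r • m ^ p
    rw [smul_pow, hr]
  by_contra hsep
  obtain ⟨n, hnS, hn⟩ : ∃ n ∈ S, n ∉ (separableClosure (adjoin k s) K).restrictScalars k := by
    by_contra! h
    apply hsep
    rw [← separableClosure.eq_top_iff, ← (restrictScalars_injective k).eq_iff,
      restrictScalars_top, eq_top_iff, ← hS, adjoin_le_iff]
    exact h
  have hns : n ∉ s := fun h ↦ hn (le_restrictScalars_separableClosure _ (subset_adjoin _ _ h))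
  obtain ⟨i, hi₁, hi₂⟩ := exists_isTranscendenceBasis_and_isSeparable_of_linearIndepOn_pow'
    p hp.out (a := id) H s n hs hns
  rw [Set.image_id] at hi₂
  have hlt : (separableClosure (adjoin k s) K).restrictScalars k <
      (separableClosure (adjoin k (insert n s \ {i})) K).restrictScalars k := by
    refine SetLike.lt_iff_le_and_exists.mpr ⟨?_, n, ?_, hn⟩
    · rw [separableClosure_le_separableClosure_iff, adjoin_le_iff]
      intro x hx
      obtain rfl | ne := eq_or_ne x i
      exacts [hi₂, le_restrictScalars_separableClosure _ (subset_adjoin _ _ ⟨.inr hx, ne⟩)]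
    · obtain rfl | ne := eq_or_ne n i
      exacts [hi₂, le_restrictScalars_separableClosure _ (subset_adjoin _ _ ⟨.inl rfl, ne⟩)]
  have : Module.Finite ((separableClosure (adjoin k s) K).restrictScalars k) K :=
    inferInstanceAs <| Module.Finite (separableClosure (adjoin k s) K) K
  have hmem : insert n s \ {i} ∈ {t : Set K | t ⊆ S ∧ IsTranscendenceBasis k ((↑) : t → K)} :=
    ⟨Set.sdiff_subset.trans (Set.insert_subset hnS hsS), hi₁⟩
  exact d.not_lt_argminOn _ hmem (by apply finrank_lt_of_gt hlt)

open scoped IntermediateField.algebraAdjoinAdjoin in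
/-- A field that is separable over a purely transcendental extension lifts along nilpotent
thickenings, with prescribed lifts of the transcendence basis. -/
theorem exists_algHom_lift_of_isSeparable {ι k K S : Type*} [Field k] [Field K] [Algebra k K]
    [CommRing S] [Algebra k S] {x : ι → K} (hx : AlgebraicIndependent k x)
    [Algebra.IsSeparable (IntermediateField.adjoin k (Set.range x)) K]
    (π : S →ₐ[k] K) (hπ : Function.Surjective π) (hker : IsNilpotent (RingHom.ker π)) (s : ι → S)
    (hs : ∀ i, π (s i) = x i) :
    ∃ ψ : K →ₐ[k] S, (∀ y, π (ψ y) = y) ∧ ∀ i, ψ (x i) = s i := by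
  let A := Algebra.adjoin k (Set.range x)
  let E := IntermediateField.adjoin k (Set.range x)
  let φ : A →ₐ[k] S := (MvPolynomial.aeval s).comp hx.aevalEquiv.symm.toAlgHom
  have hφ (i : ι) : φ ⟨x i, Algebra.subset_adjoin ⟨i, rfl⟩⟩ = s i := by
    have : hx.aevalEquiv.symm ⟨x i, Algebra.subset_adjoin ⟨i, rfl⟩⟩ = MvPolynomial.X i := by
      rw [AlgEquiv.symm_apply_eq]
      ext
      simp
    simp [φ, this]
  let _ : Algebra A S := φ.toAlgebra
  have hA (a : A) : algebraMap A S a = φ a := rfl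
  have hπφ (a : A) : π (φ a) = a := by
    obtain ⟨p, rfl⟩ := hx.aevalEquiv.surjective a
    simp only [φ, AlgHom.comp_apply]
    have : π.comp (MvPolynomial.aeval s) = MvPolynomial.aeval x := by
      ext i
      simp [hs]
    simp [← this]
  have : Algebra.FormallyEtale A E := .of_isLocalization (nonZeroDivisors A)
  have : Algebra.FormallyEtale E K := Algebra.FormallyEtale.of_isSeparable _ K
  have : Algebra.FormallyEtale A K := .comp _ E _
  let πA : S →ₐ[A] K := { (π : S →+* K) with commutes' := hπφ }
  let ψ : K →ₐ[A] S := Algebra.FormallySmooth.liftOfSurjective (AlgHom.id A K) πA hπ hker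
  have h1 : ∀ x, πA (ψ x) = x := fun x ↦
    Algebra.FormallySmooth.liftOfSurjective_apply (AlgHom.id A K) πA hπ hker x
  refine ⟨{ (ψ : K →+* S) with commutes' := fun r ↦ ?_}, h1, fun i ↦ ?_⟩
  · simp
  · exact (ψ.commutes ⟨x i, Algebra.subset_adjoin ⟨i, rfl⟩⟩).trans (hφ i)

theorem MvPolynomial.IsHomogeneous.homogeneousComponent_mul {σ R : Type*} [CommSemiring R]
    {g : MvPolynomial σ R} {a d : ℕ} (hg : g.IsHomogeneous a) (h : MvPolynomial σ R)
    (had : a ≤ d) :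
    homogeneousComponent d (g * h) = g * homogeneousComponent (d - a) h := by
  classical
  conv_lhs => rw [← sum_homogeneousComponent h]
  simp_rw [Finset.mul_sum, map_sum]
  have key (i : ℕ) : homogeneousComponent d (g * homogeneousComponent i h) =
      if i = d - a then g * homogeneousComponent (d - a) h else 0 := by
    rw [homogeneousComponent_of_mem (hg.mul (homogeneousComponent_isHomogeneous i h))]
    by_cases hi : i = d - a
    · rw [if_pos hi, if_pos (by omega), hi]
    · rw [if_neg hi, if_neg (by omega)]
  simp_rw [key, Finset.sum_ite_eq', Finset.mem_range]
  split_ifs with hlt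
  · rfl
  · rw [homogeneousComponent_eq_zero _ _ (by omega), mul_zero]

/-- A homogeneous component of an element of an ideal with homogeneous generators is a combination
of the generators with homogeneous coefficients. -/
theorem exists_homogeneousComponent_eq_sum {σ R α : Type*} [CommRing R] [Fintype α]
    {G : α → MvPolynomial σ R} {e : α → ℕ} {d : ℕ} (hG : ∀ a, (G a).IsHomogeneous (e a))
    (he : ∀ a, e a ≤ d) {F : MvPolynomial σ R} (hF : F ∈ Ideal.span (Set.range G)) :
    ∃ H : α → MvPolynomial σ R, (∀ a, (H a).IsHomogeneous (d - e a)) ∧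
      homogeneousComponent d F = ∑ a, G a * H a := by
  obtain ⟨c, rfl⟩ := (Ideal.mem_span_range_iff_exists_fun).1 hF
  refine ⟨fun a ↦ homogeneousComponent (d - e a) (c a),
    fun a ↦ homogeneousComponent_isHomogeneous _ _, ?_⟩
  simp_rw [map_sum, mul_comm (c _), fun a ↦ (hG a).homogeneousComponent_mul (c a) (he a)]

/-- The leading form of the translate of a homogeneous polynomial is that polynomial. -/
theorem homogeneousComponent_aeval_C_add_X {σ k K : Type*} [CommRing k] [CommRing K] [Algebra k K]
    (x : σ → K) {q : MvPolynomial σ k} {e : ℕ} (hq : q.IsHomogeneous e) :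
    homogeneousComponent e (aeval (fun j ↦ C (x j) + X j) q : MvPolynomial σ K) =
      map (algebraMap k K) q := by
  classical
  have key (s : Multiset σ) : (s.map fun j ↦ (C (x j) + X j : MvPolynomial σ K)).prod.totalDegree
      ≤ s.card ∧ homogeneousComponent s.card (s.map fun j ↦ (C (x j) + X j)).prod =
        (s.map (X : σ → MvPolynomial σ K)).prod := by
    induction s using Multiset.induction_on with
    | empty => simp
    | cons j s ih =>
      simp only [Multiset.map_cons, Multiset.prod_cons, Multiset.card_cons]
      constructor
      · refine (totalDegree_mul _ _).trans ?_
        rw [add_comm s.card]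
        refine add_le_add ((totalDegree_add _ _).trans ?_) ih.1
        simp only [totalDegree_C, zero_le, sup_of_le_right]
        exact (isHomogeneous_X K j).totalDegree_le
      · rw [add_mul, map_add, homogeneousComponent_C_mul,
          homogeneousComponent_eq_zero _ _ (Nat.lt_succ_of_le ih.1), mul_zero, zero_add,
          (isHomogeneous_X K j).homogeneousComponent_mul _ (by omega), Nat.add_sub_cancel, ih.2]
  rw [q.as_sum, map_sum, map_sum, map_sum]
  refine Finset.sum_congr rfl fun u hu ↦ ?_
  have hu' : (Finsupp.toMultiset u).card = e :=
    (Finsupp.card_toMultiset u).trans (hq.degree_eq_sum_deg_support hu).symm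
  have h1 (y : σ → MvPolynomial σ K) : u.prod (fun i a ↦ y i ^ a) =
      ((Finsupp.toMultiset u).map y).prod := by
    rw [Finsupp.toMultiset_map, Finsupp.prod_toMultiset, Finsupp.prod_mapDomain_index] <;>
    simp [pow_add]
  rw [aeval_monomial, map_monomial, monomial_eq, h1, h1, ← (key _).2, hu',
    IsScalarTower.algebraMap_apply k K (MvPolynomial σ K), algebraMap_eq,
    homogeneousComponent_C_mul]

/-- A decomposition into homogeneous products over an extension of an algebraically closed field
descends to the field. -/
theorem exists_eq_sum_mul_of_map_eq_sum_mul {σ k K α : Type*} [Field k] [IsAlgClosed k] [Field K]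
    [Algebra k K] [Fintype α] {f : MvPolynomial σ k} {G H : α → MvPolynomial σ K} {e e' : α → ℕ}
    (hG : ∀ a, (G a).IsHomogeneous (e a)) (hH : ∀ a, (H a).IsHomogeneous (e' a))
    (hf : map (algebraMap k K) f = ∑ a, G a * H a) :
    ∃ G' H' : α → MvPolynomial σ k, (∀ a, (G' a).IsHomogeneous (e a)) ∧
      (∀ a, (H' a).IsHomogeneous (e' a)) ∧ f = ∑ a, G' a * H' a := by
  classical
  let T : Finset K := Finset.univ.biUnion fun a ↦ (G a).coeffs ∪ (H a).coeffs
  let B := Algebra.adjoin k (T : Set K)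
  have : Algebra.FiniteType k B := .adjoin_of_finite T.finite_toSet
  obtain ⟨M, hM⟩ := Ideal.exists_maximal B
  let _ : Field (B ⧸ M) := Ideal.Quotient.field M
  have : Module.Finite k (B ⧸ M) := finite_of_finite_type_of_isJacobsonRing k (B ⧸ M)
  let ε : (B ⧸ M) ≃ₐ[k] k := (AlgEquiv.ofBijective (Algebra.ofId k (B ⧸ M))
    IsAlgClosed.algebraMap_bijective_of_isIntegral).symm
  let φ : B →ₐ[k] k := ε.toAlgHom.comp (Ideal.Quotient.mkₐ k M)
  have hinj : Function.Injective (algebraMap B K) := Subtype.val_injective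
  have hT (p : MvPolynomial σ K) (hp : p.coeffs ⊆ T) : ∃ p', map (algebraMap B K) p' = p := by
    refine mem_range_map_iff_coeffs_subset.2 fun c hc ↦ ?_
    exact ⟨⟨c, Algebra.subset_adjoin (hp hc)⟩, rfl⟩
  choose G₁ hG₁ using fun a ↦ hT (G a) fun c hc ↦
    Finset.mem_biUnion.2 ⟨a, Finset.mem_univ _, Finset.mem_union_left _ hc⟩
  choose H₁ hH₁ using fun a ↦ hT (H a) fun c hc ↦
    Finset.mem_biUnion.2 ⟨a, Finset.mem_univ _, Finset.mem_union_right _ hc⟩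
  refine ⟨fun a ↦ map φ (G₁ a), fun a ↦ map φ (H₁ a),
    fun a ↦ (IsHomogeneous.of_map hinj (by rw [hG₁]; exact hG a)).map _,
    fun a ↦ (IsHomogeneous.of_map hinj (by rw [hH₁]; exact hH a)).map _, ?_⟩
  have h₁ : map (algebraMap k B) f = ∑ a, G₁ a * H₁ a := by
    apply map_injective _ hinj
    rw [map_map, ← IsScalarTower.algebraMap_eq k B K, hf]
    simp [hG₁, hH₁]
  have h₂ := congrArg (map (φ : B →+* k)) h₁
  rw [map_map, φ.comp_algebraMap] at h₂
  simpa [map_id] using h₂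

theorem MvPolynomial.IsHomogeneous.eq_C_inv_mul_sum {σ k : Type*} [Fintype σ] [Field k]
    {f : MvPolynomial σ k} {d : ℕ} (hf : f.IsHomogeneous d) (hd : (d : k) ≠ 0) :
    f = C ((d : k)⁻¹) * ∑ j, X j * pderiv j f := by
  rw [hf.sum_X_mul_pderiv, nsmul_eq_mul, ← mul_assoc, ← map_natCast (C (R := k)), ← map_mul,
    inv_mul_cancel₀ hd, map_one, one_mul]

/-- Over an algebraically closed field, a form of degree `d` whose partial derivatives all
vanish on a variety with function field `K` of transcendence degree at least `s` is a combination
of at most `(n - s) * (d - 1)` products of forms of lower degree. -/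
theorem polySchmidtRank_le_of_aeval_pderiv_eq_zero {k K : Type} [Field k] [IsAlgClosed k]
    [Field K] [Algebra k K] {n d s : ℕ} (hd : 2 ≤ d) (hdk : (d : k) ≠ 0)
    {f : MvPolynomial (Fin n) k} (hhom : f.IsHomogeneous d) {x : Fin n → K}
    (hx : IntermediateField.adjoin k (Set.range x) = ⊤) (hf : ∀ j, aeval x (pderiv j f) = 0)
    {y : Fin s → K} (hy : AlgebraicIndependent k y) :
    polySchmidtRank f ≤ (n - s) * (d - 1) := by
  classical
  obtain ⟨t, htx, ht, hsep⟩ :=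
    exists_isTranscendenceBasis_subset_isSeparable (Set.finite_range x) hx
  choose i hi using fun u : t ↦ htx u.2
  have hi_inj : Function.Injective i := fun u v h ↦ Subtype.ext <| by rw [← hi, ← hi, h]
  have : Finite t := Finite.of_injective i hi_inj
  have := Fintype.ofFinite t
  have hst : s ≤ Fintype.card t := by
    have := hy.cardinalMk_le_trdeg
    rw [← ht.cardinalMk_eq_trdeg] at this
    simpa using this
  let m := idealOfVars (Fin n) K
  let π₀ : MvPolynomial (Fin n) K →ₐ[k] K := (aeval (0 : Fin n → K)).restrictScalars k
  have hker : RingHom.ker π₀ = m := by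
    ext p
    rw [RingHom.mem_ker, ← pow_one m, mem_pow_idealOfVars_iff']
    simp [π₀, Finsupp.degree_eq_zero_iff, aeval_zero, constantCoeff_eq]
  have hm (p : MvPolynomial (Fin n) K) (hp : p ∈ m ^ d) : π₀ p = 0 := by
    have : p ∈ m := Ideal.pow_le_self (by omega) hp
    rwa [← hker] at this
  let π : (MvPolynomial (Fin n) K ⧸ m ^ d) →ₐ[k] K := Ideal.Quotient.liftₐ _ π₀ hm
  have hπ (p : MvPolynomial (Fin n) K) : π (Ideal.Quotient.mk _ p) = π₀ p := rfl
  have hπsurj : Function.Surjective π := fun a ↦ ⟨Ideal.Quotient.mk _ (C a), by simp [hπ, π₀]⟩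
  have hπker : IsNilpotent (RingHom.ker π) := by
    have hle : RingHom.ker π ≤ m.map (Ideal.Quotient.mk (m ^ d)) := by
      intro z hz
      obtain ⟨p, rfl⟩ := Ideal.Quotient.mk_surjective z
      rw [RingHom.mem_ker, hπ] at hz
      exact Ideal.mem_map_of_mem _ (hker ▸ hz)
    refine ⟨d, le_bot_iff.1 ((Ideal.pow_right_mono hle d).trans ?_)⟩
    rw [← Ideal.map_pow, Ideal.map_quotient_self]
  have : Algebra.IsSeparable (IntermediateField.adjoin k (Set.range ((↑) : t → K))) K := by
    rwa [Subtype.range_coe]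
  obtain ⟨ψ, hψ, hψt⟩ := exists_algHom_lift_of_isSeparable ht.1 π hπsurj hπker
    (fun u ↦ Ideal.Quotient.mk _ (C (u : K) + X (i u))) (fun u ↦ by simp [hπ, π₀])
  have hξ (j : Fin n) : ∃ ξ : MvPolynomial (Fin n) K, Ideal.Quotient.mk (m ^ d) ξ = ψ (x j) ∧
      (j ∈ Set.range i → ξ = C (x j) + X j) := by
    by_cases hj : j ∈ Set.range i
    · obtain ⟨u, rfl⟩ := hj
      exact ⟨C (x (i u)) + X (i u), by rw [hi, hψt], fun _ ↦ rfl⟩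
    · obtain ⟨ξ, hξ⟩ := Ideal.Quotient.mk_surjective (ψ (x j))
      exact ⟨ξ, hξ, fun h ↦ (hj h).elim⟩
  choose ξ hξψ hξi using hξ
  let δ (j : Fin n) : MvPolynomial (Fin n) K := C (x j) + X j - ξ j
  have hδ₀ (j : Fin n) : homogeneousComponent 0 (δ j) = 0 := by
    have : π₀ (ξ j) = x j := by rw [← hπ, hξψ, hψ]
    have : coeff 0 (ξ j) = x j := by
      simpa [π₀, aeval_zero, constantCoeff_eq] using this
    simp [homogeneousComponent_zero, δ, this]
  let e (a : {j // j ∉ Set.range i} × Fin (d - 1)) : ℕ := a.2 + 1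
  let G (a : {j // j ∉ Set.range i} × Fin (d - 1)) := homogeneousComponent (e a) (δ a.1)
  have hG (a) : (G a).IsHomogeneous (e a) := homogeneousComponent_isHomogeneous _ _
  have he (a) : e a ≤ d - 1 := Nat.succ_le_of_lt a.2.2
  let J := Ideal.span (Set.range G)
  have hδ (j : Fin n) : δ j ∈ J ⊔ m ^ d := by
    by_cases hj : j ∈ Set.range i
    · simp [δ, hξi j hj]
    rw [← sum_homogeneousComponent (δ j)]
    refine Ideal.sum_mem _ fun l _ ↦ ?_
    obtain rfl | hl := Nat.eq_zero_or_pos l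
    · simp [hδ₀]
    obtain hld | hld := lt_or_ge l d
    · refine Ideal.mem_sup_left (Ideal.subset_span ⟨(⟨j, hj⟩, ⟨l - 1, by omega⟩), ?_⟩)
      simp [G, e, Nat.sub_add_cancel hl]
    · refine Ideal.mem_sup_right ((mem_pow_idealOfVars_iff' d _).2 fun u hu ↦ ?_)
      rw [coeff_homogeneousComponent, if_neg (by omega)]
  have hJ (q : MvPolynomial (Fin n) k) (hq : q.IsHomogeneous (d - 1)) (hq₀ : aeval x q = 0) :
      map (algebraMap k K) q ∈ J := by
    have h₁ : aeval ξ q ∈ m ^ d := by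
      rw [← Ideal.Quotient.eq_zero_iff_mem, ← Ideal.Quotient.mkₐ_eq_mk k, comp_aeval_apply]
      simp_rw [Ideal.Quotient.mkₐ_eq_mk, hξψ]
      rw [← comp_aeval_apply, hq₀, map_zero]
    have h₂ : (aeval (fun j ↦ C (x j) + X j) q : MvPolynomial (Fin n) K) ∈ J ⊔ m ^ d := by
      have h₃ := Ideal.Quotient.eq_zero_iff_mem.2 (Ideal.mem_sup_right (S := J) h₁)
      rw [← Ideal.Quotient.eq_zero_iff_mem, ← h₃, ← Ideal.Quotient.mkₐ_eq_mk k, comp_aeval_apply,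
        comp_aeval_apply]
      congr 2
      exact funext fun j ↦ Ideal.Quotient.eq.2 (hδ j)
    obtain ⟨a, ha, b, hb, hab⟩ := Submodule.mem_sup.1 h₂
    obtain ⟨H, -, hH⟩ := exists_homogeneousComponent_eq_sum hG he ha
    have hb₀ : homogeneousComponent (d - 1) b = 0 := by
      ext u
      rw [coeff_homogeneousComponent]
      split_ifs with hu
      · exact (mem_pow_idealOfVars_iff' d b).1 hb u (by omega)
      · simp
    rw [← homogeneousComponent_aeval_C_add_X x hq, ← hab, map_add, hb₀, add_zero, hH]
    exact Ideal.sum_mem _ fun a _ ↦ Ideal.mul_mem_right _ _ (Ideal.subset_span ⟨a, rfl⟩)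
  have hfJ : map (algebraMap k K) f ∈ J := by
    rw [hhom.eq_C_inv_mul_sum hdk]
    simp only [map_mul, map_sum]
    exact Ideal.mul_mem_left _ _ <| Ideal.sum_mem _ fun j _ ↦
      Ideal.mul_mem_left _ _ (hJ _ hhom.pderiv (hf j))
  obtain ⟨H, hH, hGH⟩ := exists_homogeneousComponent_eq_sum hG
    (fun a ↦ (he a).trans (Nat.sub_le d 1)) hfJ
  rw [homogeneousComponent_eq_self (hhom.map _)] at hGH
  obtain ⟨G', H', hG', hH', hf'⟩ := exists_eq_sum_mul_of_map_eq_sum_mul hG hH hGH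
  have hcard : Fintype.card ({j // j ∉ Set.range i} × Fin (d - 1)) ≤ (n - s) * (d - 1) := by
    rw [Fintype.card_prod, Fintype.card_fin, Fintype.card_subtype_compl, Fintype.card_fin]
    refine Nat.mul_le_mul_right _ (Nat.sub_le_sub_left ?_ _)
    rwa [← Fintype.card_congr (Equiv.ofInjective i hi_inj)]
  let E := Fintype.equivFin ({j // j ∉ Set.range i} × Fin (d - 1))
  have hmem : Fintype.card ({j // j ∉ Set.range i} × Fin (d - 1)) ∈ {r | ∃ g h : Fin r → _,
      (∀ i, ∃ a, 0 < a ∧ (g i).IsHomogeneous a) ∧ (∀ i, ∃ b, 0 < b ∧ (h i).IsHomogeneous b) ∧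
      f = ∑ i, g i * h i} := by
    refine ⟨G' ∘ E.symm, H' ∘ E.symm, fun a ↦ ⟨_, Nat.succ_pos _, hG' _⟩,
      fun a ↦ ⟨_, ?_, hH' _⟩, ?_⟩
    · have := he (E.symm a)
      omega
    · rw [hf']
      exact (E.symm.sum_comp fun a ↦ G' a * H' a).symm
  exact (Nat.sInf_le hmem).trans hcard

theorem ringKrullDim_le_of_isIntegral {A B : Type*} [CommRing A] [CommRing B] [Algebra A B]
    [Algebra.IsIntegral A B] : ringKrullDim B ≤ ringKrullDim A :=
  Order.krullDim_le_of_strictMono (PrimeSpectrum.comap (algebraMap A B)) fun _ _ hpq ↦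
    Ideal.IsIntegral.comap_lt_comap hpq

/-- A nonzero affine algebra has a prime quotient whose transcendence degree is at least the
dimension of the algebra. -/
theorem exists_isPrime_algebraicIndependent {k : Type} [Field k] {n : ℕ}
    {I : Ideal (MvPolynomial (Fin n) k)} (hI : I ≠ ⊤) :
    ∃ (s : ℕ) (P : Ideal (MvPolynomial (Fin n) k)) (y : Fin s → MvPolynomial (Fin n) k ⧸ P),
      ringKrullDim (MvPolynomial (Fin n) k ⧸ I) ≤ s ∧ P.IsPrime ∧ I ≤ P ∧
      AlgebraicIndependent k y := by
  obtain ⟨s, -, g, hinj, hint⟩ := exists_integral_inj_algHom_of_quotient I hI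
  let _ : Algebra (MvPolynomial (Fin s) k) (MvPolynomial (Fin n) k ⧸ I) := g.toAlgebra
  have : Algebra.IsIntegral (MvPolynomial (Fin s) k) (MvPolynomial (Fin n) k ⧸ I) := ⟨hint⟩
  have hker : RingHom.ker (algebraMap (MvPolynomial (Fin s) k) (MvPolynomial (Fin n) k ⧸ I)) = ⊥ :=
    (RingHom.injective_iff_ker_eq_bot _).1 hinj
  obtain ⟨Q, -, hQ, hQ'⟩ := Ideal.exists_ideal_over_prime_of_isIntegral
    (⊥ : Ideal (MvPolynomial (Fin s) k)) (⊥ : Ideal (MvPolynomial (Fin n) k ⧸ I)) hker.le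
  let P := Q.comap (Ideal.Quotient.mk I)
  have hIP : I ≤ P := fun p hp ↦ by simp [P, Ideal.Quotient.eq_zero_iff_mem.2 hp]
  choose z hz using fun j ↦ Ideal.Quotient.mk_surjective (g (X j))
  refine ⟨s, P, fun j ↦ Ideal.Quotient.mk P (z j), ?_, inferInstance, hIP, ?_⟩
  · refine (ringKrullDim_le_of_isIntegral (A := MvPolynomial (Fin s) k)).trans ?_
    rw [MvPolynomial.ringKrullDim_of_isNoetherianRing]
    simp
  · rw [algebraicIndependent_iff]
    intro p hp
    have h₁ : aeval z p ∈ P := by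
      rw [← Ideal.Quotient.eq_zero_iff_mem, ← Ideal.Quotient.mkₐ_eq_mk k, comp_aeval_apply]
      exact hp
    have h₂ : Ideal.Quotient.mk I (aeval z p) = g p := by
      rw [← Ideal.Quotient.mkₐ_eq_mk k, comp_aeval_apply]
      simp_rw [Ideal.Quotient.mkₐ_eq_mk, hz]
      rw [← comp_aeval_apply, aeval_X_left_apply]
    have h₃ : p ∈ Q.comap (algebraMap (MvPolynomial (Fin s) k) _) := by
      change g p ∈ Q
      rw [← h₂]
      exact h₁
    rwa [hQ', Ideal.mem_bot] at h₃

theorem adjoin_range_algebraMap_mk_X_eq_top {σ k K : Type*} [Field k] [Field K]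
    {P : Ideal (MvPolynomial σ k)} [Algebra k K] [Algebra (MvPolynomial σ k ⧸ P) K]
    [IsScalarTower k (MvPolynomial σ k ⧸ P) K] [IsFractionRing (MvPolynomial σ k ⧸ P) K] :
    IntermediateField.adjoin k
      (Set.range fun j ↦ algebraMap (MvPolynomial σ k ⧸ P) K (Ideal.Quotient.mk P (X j))) = ⊤ := by
  rw [eq_top_iff]
  rintro z -
  have key (a : MvPolynomial σ k ⧸ P) : algebraMap _ K a ∈ IntermediateField.adjoin k
      (Set.range fun j ↦ algebraMap (MvPolynomial σ k ⧸ P) K (Ideal.Quotient.mk P (X j))) := by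
    obtain ⟨p, rfl⟩ := Ideal.Quotient.mk_surjective a
    induction p using MvPolynomial.induction_on with
    | C c =>
      have : algebraMap (MvPolynomial σ k ⧸ P) K (Ideal.Quotient.mk P (C c)) = algebraMap k K c :=
        (IsScalarTower.algebraMap_apply k (MvPolynomial σ k ⧸ P) K c).symm
      rw [this]
      exact IntermediateField.algebraMap_mem _ c
    | add p q hp hq => simpa using add_mem hp hq
    | mul_X p j hp => simpa using mul_mem hp (IntermediateField.subset_adjoin _ _ ⟨j, rfl⟩)
  obtain ⟨a, b, -, rfl⟩ := IsFractionRing.div_surjective (A := MvPolynomial σ k ⧸ P) z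
  exact div_mem (key a) (key b)

theorem natCast_le_height_ker_constantCoeff (k : Type*) [Field k] (n : ℕ) :
    (n : ℕ∞) ≤ (RingHom.ker (constantCoeff : MvPolynomial (Fin n) k →+* k)).height := by
  let φ (i : ℕ) : MvPolynomial (Fin n) k →ₐ[k] MvPolynomial (Fin n) k :=
    aeval fun j ↦ if j < i then 0 else X j
  have hφ (i : ℕ) : (φ (i + 1)).comp (φ i) = φ (i + 1) := by
    ext1 j
    by_cases hj : (j : ℕ) < i
    · simp [φ, hj, hj.le]
    · simp [φ, hj]
  have key (i : ℕ) (hi : i ≤ n) : (i : ℕ∞) ≤ (RingHom.ker (φ i)).height := by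
    induction i with
    | zero => simp
    | succ i ih =>
      have hlt : RingHom.ker (φ i) < RingHom.ker (φ (i + 1)) := by
        refine SetLike.lt_iff_le_and_exists.2 ⟨fun p hp ↦ ?_, X ⟨i, hi⟩, ?_, ?_⟩
        · rw [RingHom.mem_ker] at hp ⊢
          rw [← hφ, AlgHom.comp_apply, hp, map_zero]
        · simp [φ]
        · simp [φ]
      have := RingHom.ker_isPrime (φ i)
      have := RingHom.ker_isPrime (φ (i + 1))
      push_cast
      grw [ih (by omega)]
      exact Ideal.height_add_one_le_of_lt_of_isPrime hlt
  refine (key n le_rfl).trans (Ideal.height_mono fun p hp ↦ ?_)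
  have h : aeval (fun _ : Fin n ↦ (0 : MvPolynomial (Fin n) k)) p = 0 := by
    simpa [φ] using (RingHom.mem_ker).1 hp
  rwa [aeval_zero', algebraMap_eq, C_eq_zero] at h

theorem MvPolynomial.IsHomogeneous.constantCoeff_eq_zero {σ R : Type*} [CommSemiring R]
    {p : MvPolynomial σ R} {a : ℕ} (hp : p.IsHomogeneous a) (ha : 0 < a) : constantCoeff p = 0 :=
  hp.coeff_eq_zero (by simpa using ha.ne)

theorem singIdeal_ne_top {k : Type} [Field k] {n d : ℕ} (hd : 2 ≤ d)
    {f : MvPolynomial (Fin n) k} (hhom : f.IsHomogeneous d) :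
    singIdeal f ≠ ⊤ := by
  have hle : singIdeal f ≤ RingHom.ker (constantCoeff : MvPolynomial (Fin n) k →+* k) := by
    refine Ideal.span_le.2 ?_
    rintro _ (rfl | ⟨i, rfl⟩)
    · exact hhom.constantCoeff_eq_zero (by omega)
    · exact hhom.pderiv.constantCoeff_eq_zero (by omega)
  exact fun h ↦ RingHom.ker_ne_top _ (top_le_iff.1 (h ▸ hle))

/-- The codimension of a proper ideal is the complement of the dimension of its quotient. -/
theorem affineCodim_eq {k : Type} [Field k] {n : ℕ} {I : Ideal (MvPolynomial (Fin n) k)}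
    (hI : I ≠ ⊤) : ∃ m : ℕ∞, ringKrullDim (MvPolynomial (Fin n) k ⧸ I) = m ∧
      affineCodim k I = n - m := by
  have := Ideal.Quotient.nontrivial_iff.2 hI
  obtain ⟨m, hm⟩ := WithBot.ne_bot_iff_exists.1
    (bot_lt_iff_ne_bot.1 <| (WithBot.bot_lt_coe 0).trans_le
      (ringKrullDim_nonneg_of_nontrivial (R := MvPolynomial (Fin n) k ⧸ I)))
  refine ⟨m, hm.symm, ?_⟩
  rw [affineCodim, affineDim, ← hm]
  simp

theorem affineCodim_singIdeal_le {k : Type} [Field k] {n r d : ℕ} (hd : 2 ≤ d)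
    {f : MvPolynomial (Fin n) k} (hhom : f.IsHomogeneous d) {g h : Fin r → MvPolynomial (Fin n) k}
    (hg : ∀ i, ∃ a, 0 < a ∧ (g i).IsHomogeneous a) (hh : ∀ i, ∃ b, 0 < b ∧ (h i).IsHomogeneous b)
    (hf : f = ∑ i, g i * h i) : affineCodim k (singIdeal f) ≤ 2 * (r : ℕ∞) := by
  let p := RingHom.ker (constantCoeff : MvPolynomial (Fin n) k →+* k)
  let s := Set.range g ∪ Set.range h
  have hsp : s ⊆ p := by
    rintro _ (⟨i, rfl⟩ | ⟨i, rfl⟩)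
    · obtain ⟨a, ha, hga⟩ := hg i
      exact hga.constantCoeff_eq_zero ha
    · obtain ⟨a, ha, hha⟩ := hh i
      exact hha.constantCoeff_eq_zero ha
  have hgs (i : Fin r) : g i ∈ Ideal.span s := Ideal.subset_span (.inl ⟨i, rfl⟩)
  have hhs (i : Fin r) : h i ∈ Ideal.span s := Ideal.subset_span (.inr ⟨i, rfl⟩)
  have hle : singIdeal f ≤ Ideal.span s := by
    refine Ideal.span_le.2 ?_
    rintro _ (rfl | ⟨j, rfl⟩)
    · rw [hf]
      exact Ideal.sum_mem _ fun i _ ↦ Ideal.mul_mem_left _ _ (hhs i)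
    · dsimp only
      rw [hf, map_sum]
      refine Ideal.sum_mem _ fun i _ ↦ ?_
      rw [Derivation.leibniz, smul_eq_mul, smul_eq_mul]
      exact add_mem (Ideal.mul_mem_right _ _ (hgs i)) (Ideal.mul_mem_right _ _ (hhs i))
  have hs : s.encard ≤ 2 * r := by
    have hcard (u : Fin r → MvPolynomial (Fin n) k) : (Set.range u).encard ≤ r := by
      rw [← Set.image_univ]
      refine (Set.encard_image_le _ _).trans ?_
      simp
    rw [two_mul]
    exact (Set.encard_union_le _ _).trans (add_le_add (hcard g) (hcard h))
  have : p.IsPrime := RingHom.ker_isPrime _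
  obtain ⟨m, hm, hcodim⟩ := affineCodim_eq (singIdeal_ne_top hd hhom)
  have hdim := Ideal.height_le_ringKrullDim_quotient_add_encard s hsp
  have hquot : ringKrullDim (MvPolynomial (Fin n) k ⧸ Ideal.span s) ≤ m := by
    rw [← hm]
    exact ringKrullDim_le_of_surjective (Ideal.Quotient.factor hle)
      (Ideal.Quotient.factor_surjective hle)
  have hn : (n : ℕ∞) ≤ m + 2 * r := by
    have h₁ : ((n : ℕ∞) : WithBot ℕ∞) ≤ (m + 2 * r : ℕ∞) := by
      push_cast
      calc ((n : ℕ∞) : WithBot ℕ∞) ≤ p.height :=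
            WithBot.coe_le_coe.2 (natCast_le_height_ker_constantCoeff k n)
        _ ≤ _ := hdim
        _ ≤ _ := add_le_add hquot (WithBot.coe_le_coe.2 hs)
    exact WithBot.coe_le_coe.1 h₁
  rw [hcodim, tsub_le_iff_left]
  exact hn

theorem polySchmidtRank_le_affineCodim_mul {k : Type} [Field k] [IsAlgClosed k] {n d : ℕ}
    (hd : 2 ≤ d) (hdk : (d : k) ≠ 0) {f : MvPolynomial (Fin n) k} (hhom : f.IsHomogeneous d) :
    (polySchmidtRank f : ℕ∞) ≤ affineCodim k (singIdeal f) * (d - 1 : ℕ) := by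
  have hI := singIdeal_ne_top hd hhom
  obtain ⟨s, P, y, hdim, hP, hIP, hy⟩ := exists_isPrime_algebraicIndependent hI
  obtain ⟨m, hm, hcodim⟩ := affineCodim_eq hI
  let K := FractionRing (MvPolynomial (Fin n) k ⧸ P)
  let ι : (MvPolynomial (Fin n) k ⧸ P) →ₐ[k] K := IsScalarTower.toAlgHom k _ K
  have hι : Function.Injective ι := IsFractionRing.injective (MvPolynomial (Fin n) k ⧸ P) K
  have hrank := polySchmidtRank_le_of_aeval_pderiv_eq_zero hd hdk hhom
    (adjoin_range_algebraMap_mk_X_eq_top (P := P) (K := K)) (fun j ↦ ?_)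
    (hy.map' (f := ι) hι)
  · have hms : m ≤ s := by
      rw [hm] at hdim
      exact WithBot.coe_le_coe.1 hdim
    calc (polySchmidtRank f : ℕ∞) ≤ ((n - s) * (d - 1) : ℕ) := by exact_mod_cast hrank
      _ = ((n : ℕ∞) - s) * (d - 1 : ℕ) := by push_cast; rfl
      _ ≤ _ := by
        rw [hcodim]
        gcongr
  · have h₁ : Ideal.Quotient.mk P (pderiv j f) = 0 :=
      Ideal.Quotient.eq_zero_iff_mem.2 (hIP (Ideal.subset_span (.inr ⟨j, rfl⟩)))
    have h₂ := comp_aeval_apply (fun j ↦ X j) (ι.comp (Ideal.Quotient.mkₐ k P)) (pderiv j f)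
    rw [aeval_X_left_apply] at h₂
    refine h₂.symm.trans ?_
    simp [h₁]

/-- Theorem 1.5(i). Let `k` be algebraically closed with
`char k ∤ d(d-1)`, `d ≥ 3`, and `f` a nonzero homogeneous polynomial of degree `d` on `V`.
Then `(1/2)·c(f) ≤ rk^S(f) ≤ 2^{d-3}·(d+1)·c(f)`, and for odd `d` moreover
`rk^S(f) ≤ 2^{d-3}·d·c(f)`, where `c(f)` is the codimension in `V` of the singular locus of
the hypersurface `f = 0`. -/
theorem half_c_le_schmidtRank_le {k : Type} [Field k] [IsAlgClosed k] {n d : ℕ}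
    (hd : 3 ≤ d) (hchar : ¬ (ringChar k ∣ d * (d - 1)))
    (f : MvPolynomial (Fin n) k) (hf : f ≠ 0) (hhom : f.IsHomogeneous d) :
    affineCodim k (singIdeal f) ≤ 2 * (polySchmidtRank f : ℕ∞) ∧
      (polySchmidtRank f : ℕ∞) ≤
        ((2 ^ (d - 3) * (d + 1) : ℕ) : ℕ∞) * affineCodim k (singIdeal f) ∧
      (Odd d → (polySchmidtRank f : ℕ∞) ≤
        ((2 ^ (d - 3) * d : ℕ) : ℕ∞) * affineCodim k (singIdeal f)) := by

  have hdk : (d : k) ≠ 0 := fun h ↦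
    hchar (((ringChar.spec k d).1 h).mul_right _)
  have hupper := polySchmidtRank_le_affineCodim_mul (by omega) hdk hhom
  have hpow : 1 ≤ 2 ^ (d - 3) := Nat.one_le_two_pow
  have hle {N : ℕ} (hN : d - 1 ≤ N) :
      (polySchmidtRank f : ℕ∞) ≤ (N : ℕ∞) * affineCodim k (singIdeal f) := by
    refine hupper.trans ?_
    rw [mul_comm]
    gcongr
  refine ⟨?_, hle (by nlinarith [Nat.sub_le d 1]), fun _ ↦ hle (by nlinarith [Nat.sub_le d 1])⟩
  have hne : {r | ∃ g h : Fin r → MvPolynomial (Fin n) k,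
      (∀ i, ∃ a, 0 < a ∧ (g i).IsHomogeneous a) ∧ (∀ i, ∃ b, 0 < b ∧ (h i).IsHomogeneous b) ∧
      f = ∑ i, g i * h i}.Nonempty := by
    refine ⟨n, fun i ↦ C ((d : k)⁻¹) * X i, fun i ↦ pderiv i f,
      fun i ↦ ⟨1, one_pos, (isHomogeneous_X k i).C_mul _⟩,
      fun i ↦ ⟨d - 1, by omega, hhom.pderiv⟩, ?_⟩
    simp_rw [mul_assoc, ← Finset.mul_sum]
    exact hhom.eq_C_inv_mul_sum hdk
  obtain ⟨g, h, hg, hh, hfgh⟩ := Nat.sInf_mem hne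
  exact affineCodim_singIdeal_le (by omega) hhom hg hh hfgh
end

section
/- Let k be an algebraically closed field whose characteristic does not divide d(d−1), with d ≥ 3, V a finite-dimensional k-vector space, and f̄ = (f_1,…,f_s) a collection of homogeneous polynomials of degree d on V. If rk^S(f̄) ≥ 2^{d−3}·(d+1)·(2s−1) (respectively rk^S(f̄) ≥ 2^{d−3}·d·(2s−1) when d is odd), then (f_1,…,f_s) define a complete intersection V(f̄) of codimension s in V. If moreover rk^S(f̄) ≥ 2^{d−3}·(d+1)·(2s+1) (respectively rk^S(f̄) ≥ 2^{d−3}·d·(2s+1) when d is odd), then the scheme V(f̄) is normal. -/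
open MvPolynomial

/-- The Schmidt rank of a collection of polynomials: the minimum of the Schmidt ranks of all
nontrivial linear combinations. -/
noncomputable def polySchmidtRankFamily {k : Type} [Field k] {σ : Type} {s : ℕ}
    (f : Fin s → MvPolynomial σ k) : ℕ :=
  sInf {r | ∃ c : Fin s → k, c ≠ 0 ∧ polySchmidtRank (∑ i, c i • f i) = r}

/-- The closed subscheme of affine space cut out by an ideal `I` is a normal scheme: all of
its local rings (the localizations of its coordinate ring at primes) are integrally closed
domains. -/
def IsNormalZeroLocus {k : Type} [Field k] {n : ℕ}
    (I : Ideal (MvPolynomial (Fin n) k)) : Prop :=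
  ∀ q : PrimeSpectrum (MvPolynomial (Fin n) k ⧸ I),
    IsDomain (Localization.AtPrime q.asIdeal) ∧
      IsIntegrallyClosed (Localization.AtPrime q.asIdeal)

namespace MvPolynomial

lemma homogeneousComponent_monomial {σ R : Type*} [CommSemiring R] (e : ℕ) (m : σ →₀ ℕ) (a : R) :
    homogeneousComponent e (monomial m a) = if e = m.degree then monomial m a else 0 :=
  homogeneousComponent_of_mem (isHomogeneous_monomial a rfl)

lemma homogeneousComponent_mul {σ R : Type*} [CommSemiring R] (e : ℕ) (p q : MvPolynomial σ R) :
    homogeneousComponent e (p * q) = ∑ x ∈ Finset.HasAntidiagonal.antidiagonal e,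
      homogeneousComponent x.1 p * homogeneousComponent x.2 q := by
  induction p using MvPolynomial.induction_on' with
  | add p p' hp hp' => simp only [add_mul, map_add, hp, hp', Finset.sum_add_distrib]
  | monomial m a =>
    induction q using MvPolynomial.induction_on' with
    | add q q' hq hq' => simp only [mul_add, map_add, hq, hq', Finset.sum_add_distrib]
    | monomial m' a' =>
      have h : ∀ x ∈ Finset.HasAntidiagonal.antidiagonal e,
          homogeneousComponent x.1 (monomial m a) * homogeneousComponent x.2 (monomial m' a') =
          if x = (m.degree, m'.degree) then monomial m a * monomial m' a' else 0 := by
        rintro ⟨x, y⟩ -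
        rw [homogeneousComponent_monomial, homogeneousComponent_monomial]
        by_cases h1 : x = m.degree <;> by_cases h2 : y = m'.degree <;> simp [h1, h2]
      rw [Finset.sum_congr rfl h, Finset.sum_ite_eq', monomial_mul, homogeneousComponent_monomial]
      simp [Finset.HasAntidiagonal.mem_antidiagonal, eq_comm]

/-- The substitution `X ↦ X + x`. -/
noncomputable def translate {σ R : Type*} [CommSemiring R] (x : σ → R) :
    MvPolynomial σ R →ₐ[R] MvPolynomial σ R :=
  aeval fun i => X i + C (x i)

lemma homogeneousComponent_zero_translate {σ R : Type*} [CommSemiring R] (x : σ → R)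
    (p : MvPolynomial σ R) :
    homogeneousComponent 0 (translate x p) = C (eval x p) := by
  rw [homogeneousComponent_zero, ← constantCoeff_eq]
  congr 1
  have : (constantCoeff.comp (translate x).toRingHom : MvPolynomial σ R →+* R) = eval x := by
    ext <;> simp [translate]
  exact congrArg (fun g => g p) this

lemma homogeneousComponent_translate_of_isHomogeneous {σ R : Type*} [CommSemiring R] (x : σ → R)
    {d : ℕ} {F : MvPolynomial σ R} (hF : F.IsHomogeneous d) :
    homogeneousComponent d (translate x F) = F ∧
      ∀ e, d < e → homogeneousComponent e (translate x F) = 0 := by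
  have key : ∀ (m : σ →₀ ℕ) (a : R),
      homogeneousComponent m.degree (translate x (monomial m a)) = monomial m a ∧
      ∀ e, m.degree < e → homogeneousComponent e (translate x (monomial m a)) = 0 := by
    have hX : ∀ i : σ, (X i + C (x i) : MvPolynomial σ R) =
        monomial (Finsupp.single i 1) 1 + monomial 0 (x i) := fun i => rfl
    have h0 : ∀ a : R, homogeneousComponent 0 (translate x (monomial 0 a)) = monomial 0 a ∧
        ∀ e, 0 < e → homogeneousComponent e (translate x (monomial 0 a)) = 0 := by
      intro a
      have h1 : translate x (monomial 0 a) = monomial 0 a := by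
        simp [translate]
      refine ⟨by simp, fun e he => ?_⟩
      rw [h1, homogeneousComponent_monomial, map_zero, if_neg he.ne']
    intro m a
    induction m using Finsupp.induction_linear generalizing a with
    | zero =>
      simpa using h0 a
    | add m m' h h' =>
      have e1 : (monomial (m + m') a : MvPolynomial σ R) = monomial m a * monomial m' 1 := by
        simp [monomial_mul]
      have zero : ∀ y : ℕ × ℕ, m.degree < y.1 ∨ m'.degree < y.2 →
          homogeneousComponent y.1 (translate x (monomial m a)) *
            homogeneousComponent y.2 (translate x (monomial m' 1)) = 0 := by
        rintro y (hy | hy)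
        · rw [(h a).2 _ hy, zero_mul]
        · rw [(h' 1).2 _ hy, mul_zero]
      rw [e1, map_mul, map_add]
      constructor
      · rw [homogeneousComponent_mul, Finset.sum_eq_single (m.degree, m'.degree), (h a).1, (h' 1).1]
        · rintro ⟨y, z⟩ hy hne
          refine zero _ ?_
          simp only [Finset.HasAntidiagonal.mem_antidiagonal, ne_eq, Prod.mk.injEq] at hy hne ⊢
          omega
        · simp
      · intro e he
        rw [homogeneousComponent_mul]
        refine Finset.sum_eq_zero fun y hy => zero y ?_
        simp only [Finset.HasAntidiagonal.mem_antidiagonal] at hy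
        omega
    | single i b =>
      induction b generalizing a with
      | zero =>
        simpa using h0 a
      | succ b ih =>
        have e1 : (monomial (Finsupp.single i (b + 1)) a : MvPolynomial σ R) =
            monomial (Finsupp.single i b) a * X i := by
          rw [X, monomial_mul, ← Finsupp.single_add, mul_one]
        have hc : ∀ e, homogeneousComponent e (translate x (X i)) =
            (if e = 1 then X i else 0) + (if e = 0 then C (x i) else 0) := by
          intro e
          simp only [translate, aeval_X, hX, map_add, homogeneousComponent_monomial,
            Finsupp.degree_single, map_zero]
          rfl
        simp only [Finsupp.degree_single] at ih ⊢
        rw [e1, map_mul]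
        constructor
        · rw [homogeneousComponent_mul, Finset.sum_eq_single (b, 1), (ih a).1, hc]
          · simp
          · rintro ⟨y, z⟩ hy hne
            simp only [Finset.HasAntidiagonal.mem_antidiagonal, ne_eq, Prod.mk.injEq] at hy hne ⊢
            rcases lt_or_ge b y with h | h
            · rw [(ih a).2 _ h, zero_mul]
            · rw [hc, if_neg (by omega), if_neg (by omega), add_zero, mul_zero]
          · simp
        · intro e he
          rw [homogeneousComponent_mul]
          refine Finset.sum_eq_zero ?_
          rintro ⟨y, z⟩ hy
          simp only [Finset.HasAntidiagonal.mem_antidiagonal] at hy ⊢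
          rcases lt_or_ge b y with h | h
          · rw [(ih a).2 _ h, zero_mul]
          · rw [hc, if_neg (by omega), if_neg (by omega), add_zero, mul_zero]
  have hdeg : ∀ m ∈ F.support, m.degree = d := fun m hm => by
    by_contra h
    exact (mem_support_iff.1 hm) (hF.coeff_eq_zero h)
  constructor
  · conv_lhs => rw [F.as_sum]
    rw [map_sum, map_sum]
    conv_rhs => rw [F.as_sum]
    refine Finset.sum_congr rfl fun m hm => ?_
    rw [← hdeg m hm]
    exact (key m _).1
  · intro e he
    rw [F.as_sum, map_sum, map_sum]
    refine Finset.sum_eq_zero fun m hm => (key m _).2 e ?_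
    rwa [hdeg m hm]

lemma homogeneousComponent_pow_eq_zero {σ R : Type*} [CommSemiring R] {w : MvPolynomial σ R}
    (hw : homogeneousComponent 0 w = 0) {e m : ℕ} (h : e < m) :
    homogeneousComponent e (w ^ m) = 0 := by
  induction m generalizing e with
  | zero => omega
  | succ m ih =>
    rw [pow_succ, homogeneousComponent_mul]
    refine Finset.sum_eq_zero ?_
    rintro ⟨y, z⟩ hy
    simp only [Finset.HasAntidiagonal.mem_antidiagonal] at hy ⊢
    rcases Nat.eq_zero_or_pos z with rfl | hz
    · rw [hw, mul_zero]
    · rw [ih (by omega), zero_mul]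

end MvPolynomial

lemma polySchmidtRank_le_of_mul_eq_sum {k : Type} [Field k] {σ : Type} {d h : ℕ} (hd : 1 ≤ d)
    {F u : MvPolynomial σ k} (hF : F.IsHomogeneous d) {p r : Fin h → MvPolynomial σ k}
    (x : σ → k) (hu : eval x u ≠ 0) (hp : ∀ j, eval x (p j) = 0) (hr : ∀ j, eval x (r j) = 0)
    (huF : u * F = ∑ j, p j * r j) : polySchmidtRank F ≤ h * (d - 1) := by
  set τ := MvPolynomial.translate x
  set w : MvPolynomial σ k := 1 - C (eval x u)⁻¹ * τ u with hw
  set v : MvPolynomial σ k := C (eval x u)⁻¹ * ∑ i ∈ Finset.range (d + 1), w ^ i with hv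
  have hw0 : homogeneousComponent 0 w = 0 := by
    rw [hw, map_sub, homogeneousComponent_C_mul, homogeneousComponent_zero_translate, ← C_mul,
      inv_mul_cancel₀ hu, homogeneousComponent_zero]
    simp
  have huv : τ u * v = 1 - w ^ (d + 1) := by
    have := mul_neg_geom_sum w (d + 1)
    rw [← this, hv, hw]
    ring
  have hFsum : F = ∑ j, homogeneousComponent d (τ (p j) * (τ (r j) * v)) := by
    have e1 : τ F = (∑ j, τ (p j) * (τ (r j) * v)) + τ F * w ^ (d + 1) := by
      have e2 : τ u * τ F = ∑ j, τ (p j) * τ (r j) := by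
        rw [← map_mul, huF, map_sum]; simp only [map_mul]
      have e3 : (∑ j, τ (p j) * (τ (r j) * v)) = τ u * τ F * v := by
        rw [e2, Finset.sum_mul]; simp only [mul_assoc]
      rw [e3]
      linear_combination (-τ F) * huv
    have e4 := congrArg (homogeneousComponent d) e1
    rw [(homogeneousComponent_translate_of_isHomogeneous x hF).1, map_add, map_sum] at e4
    have e5 : homogeneousComponent d (τ F * w ^ (d + 1)) = 0 := by
      rw [homogeneousComponent_mul]
      refine Finset.sum_eq_zero ?_
      rintro ⟨y, z⟩ hy
      simp only [Finset.HasAntidiagonal.mem_antidiagonal] at hy ⊢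
      rw [homogeneousComponent_pow_eq_zero hw0 (by omega), mul_zero]
    rwa [e5, add_zero] at e4
  have hcomp : ∀ j, homogeneousComponent d (τ (p j) * (τ (r j) * v)) =
      ∑ a : Fin (d - 1), homogeneousComponent (a + 1) (τ (p j)) *
        homogeneousComponent (d - (a + 1)) (τ (r j) * v) := by
    intro j
    have hp0 : homogeneousComponent 0 (τ (p j)) = 0 := by
      rw [homogeneousComponent_zero_translate, hp, C_0]
    have hr0 : homogeneousComponent 0 (τ (r j) * v) = 0 := by
      rw [homogeneousComponent_mul]
      simp [τ, homogeneousComponent_zero_translate, hr, -homogeneousComponent_zero]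
    obtain ⟨e, rfl⟩ : ∃ e, d = e + 1 := ⟨d - 1, by omega⟩
    rw [homogeneousComponent_mul,
      Finset.Nat.sum_antidiagonal_eq_sum_range_succ
        (fun a b => homogeneousComponent a (τ (p j)) * homogeneousComponent b (τ (r j) * v)),
      Finset.sum_range_succ, Finset.sum_range_succ']
    simp only [hp0, zero_mul, add_zero, Nat.sub_self, hr0, mul_zero]
    rw [Finset.sum_range]
    rfl
  refine Nat.sInf_le ⟨fun i => homogeneousComponent ((finProdFinEquiv.symm i).2 + 1)
      (τ (p (finProdFinEquiv.symm i).1)), fun i =>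
      homogeneousComponent (d - ((finProdFinEquiv.symm i).2 + 1))
      (τ (r (finProdFinEquiv.symm i).1) * v), fun i =>
      ⟨_, Nat.succ_pos _, homogeneousComponent_isHomogeneous _ _⟩, fun i =>
      ⟨_, ?_, homogeneousComponent_isHomogeneous _ _⟩, ?_⟩
  · have := (finProdFinEquiv.symm i).2.2
    omega
  · conv_lhs => rw [hFsum]
    simp only [hcomp]
    rw [← Fintype.sum_prod_type']
    exact (Fintype.sum_equiv finProdFinEquiv.symm _ _ fun i => rfl).symm

section

open IsLocalRing

lemma derivation_eq_sum_pderiv {k σ M : Type*} [CommRing k] [Fintype σ] [AddCommGroup M]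
    [Module k M] [Module (MvPolynomial σ k) M] [IsScalarTower k (MvPolynomial σ k) M]
    (D : Derivation k (MvPolynomial σ k) M) (q : MvPolynomial σ k) :
    D q = ∑ i, pderiv i q • D (X i) := by
  classical
  induction q using MvPolynomial.induction_on with
  | C a => simp
  | add p q hp hq => simp only [map_add, hp, hq, add_smul, Finset.sum_add_distrib]
  | mul_X p i hp =>
    simp [hp, Derivation.leibniz, add_smul, Finset.sum_add_distrib, mul_smul, Finset.smul_sum,
      pderiv_X, Pi.single_apply, ite_smul]

section Jacobian

variable {k : Type} [Field k] {n : ℕ}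

/-- The gradient of a polynomial, with entries reduced to the residue field of a prime. -/
noncomputable def residueGradient (P : Ideal (MvPolynomial (Fin n) k)) [P.IsPrime] :
    MvPolynomial (Fin n) k →+ (Fin n → P.ResidueField) where
  toFun q l := algebraMap _ _ (pderiv l q)
  map_zero' := by ext; simp
  map_add' _ _ := by ext; simp

variable (P : Ideal (MvPolynomial (Fin n) k)) [P.IsPrime]

lemma residueGradient_mul_of_mem (a : MvPolynomial (Fin n) k) {q : MvPolynomial (Fin n) k}
    (hq : q ∈ P) : residueGradient P (a * q) =
      algebraMap _ P.ResidueField a • residueGradient P q := by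
  ext l
  have : algebraMap _ P.ResidueField q = 0 := Ideal.algebraMap_residueField_eq_zero.2 hq
  simp [residueGradient, Derivation.leibniz, this]

lemma residueGradient_eq_zero_iff {q : MvPolynomial (Fin n) k} :
    residueGradient P q = 0 ↔ ∀ l, pderiv l q ∈ P := by
  simp [funext_iff, residueGradient]

lemma residueGradient_eq_zero_of_mem_sq {q : MvPolynomial (Fin n) k} (hq : q ∈ P)
    (h : algebraMap _ (Localization.AtPrime P) q ∈ maximalIdeal (Localization.AtPrime P) ^ 2) :
    residueGradient P q = 0 := by
  rw [← Localization.AtPrime.map_eq_maximalIdeal, ← Ideal.map_pow,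
    IsLocalization.algebraMap_mem_map_algebraMap_iff P.primeCompl] at h
  obtain ⟨u, hu, huq⟩ := h
  have h1 : residueGradient P (u * q) = 0 := by
    rw [residueGradient_eq_zero_iff]
    intro l
    rw [pow_two] at huq
    refine Submodule.mul_induction_on huq (fun a ha b hb => ?_) fun a b ha hb => ?_
    · rw [Derivation.leibniz]
      exact P.add_mem (P.mul_mem_right _ ha) (P.mul_mem_right _ hb)
    · rw [map_add]; exact P.add_mem ha hb
  rw [residueGradient_mul_of_mem P u hq] at h1
  refine (smul_eq_zero.1 h1).resolve_left fun h2 => hu (Ideal.algebraMap_residueField_eq_zero.1 h2)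

lemma mem_sq_of_residueGradient_eq_zero [PerfectField k] {q : MvPolynomial (Fin n) k} (hq : q ∈ P)
    (h : residueGradient P q = 0) :
    algebraMap _ (Localization.AtPrime P) q ∈ maximalIdeal (Localization.AtPrime P) ^ 2 := by
  let S := Localization.AtPrime P
  let R := MvPolynomial (Fin n) k
  have : IsScalarTower k S P.ResidueField := .of_algebraMap_eq fun _ => rfl
  have : Algebra.EssFiniteType R S := .of_isLocalization _ P.primeCompl
  have : Algebra.EssFiniteType k S := .comp k R S
  have : Algebra.EssFiniteType k P.ResidueField := .comp k S P.ResidueField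
  have : Algebra.FormallySmooth k P.ResidueField := .of_perfectField
  have : Algebra.FormallySmooth R S := .of_isLocalization P.primeCompl
  have : Algebra.FormallySmooth k S := .comp k R S
  obtain ⟨l, hl⟩ := (Algebra.FormallySmooth.iff_split_injection (R := k) (P := S)
    (A := P.ResidueField) residue_surjective).1 inferInstance
  have hker : RingHom.ker (algebraMap S P.ResidueField) = maximalIdeal S := ker_residue
  have hqM : algebraMap R S q ∈ RingHom.ker (algebraMap S P.ResidueField) := by
    rw [hker]; exact (IsLocalization.AtPrime.to_map_mem_maximal_iff S P q).2 hq
  have hD : KaehlerDifferential.D k S (algebraMap R S q) =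
      ∑ i, algebraMap R S (pderiv i q) • KaehlerDifferential.D k S (algebraMap R S (X i)) := by
    refine (derivation_eq_sum_pderiv ((KaehlerDifferential.D k S).compAlgebraMap R) q).trans ?_
    refine Finset.sum_congr rfl fun i _ => ?_
    exact (algebraMap_smul S (pderiv i q)
      (KaehlerDifferential.D k S (algebraMap R S (X i)))).symm
  have hT : KaehlerDifferential.kerCotangentToTensor k S P.ResidueField
      ((RingHom.ker (algebraMap S P.ResidueField)).toCotangent ⟨_, hqM⟩) = 0 := by
    rw [KaehlerDifferential.kerCotangentToTensor_toCotangent, hD, TensorProduct.tmul_sum]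
    refine Finset.sum_eq_zero fun i _ => ?_
    refine ((TensorProduct.mk S P.ResidueField Ω[S⁄k] 1).map_smul (algebraMap R S (pderiv i q))
      (KaehlerDifferential.D k S (algebraMap R S (X i)))).trans ?_
    rw [TensorProduct.mk_apply]
    rw [TensorProduct.smul_tmul', Algebra.smul_def,
      ← IsScalarTower.algebraMap_apply,
      Ideal.algebraMap_residueField_eq_zero.2 ((residueGradient_eq_zero_iff P).1 h i), zero_mul,
      TensorProduct.zero_tmul]
  have h0 := congrArg l hT
  rw [map_zero, ← LinearMap.comp_apply, hl, LinearMap.id_apply, Ideal.toCotangent_eq_zero] at h0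
  rwa [← hker]

/-- The class of an element of `P` in the cotangent space of the local ring at `P`. -/
noncomputable def cotangentClass : P →+ CotangentSpace (Localization.AtPrime P) where
  toFun q := (maximalIdeal (Localization.AtPrime P)).toCotangent
    ⟨algebraMap _ _ q.1, (IsLocalization.AtPrime.to_map_mem_maximal_iff _ P q.1).2 q.2⟩
  map_zero' := by
    rw [Ideal.toCotangent_eq_zero]
    simp
  map_add' q q' := by
    rw [← map_add]
    congr 1
    ext
    simp

lemma cotangentClass_apply (q : P) : cotangentClass P q =
    (maximalIdeal (Localization.AtPrime P)).toCotangent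
    ⟨algebraMap _ _ q.1, (IsLocalization.AtPrime.to_map_mem_maximal_iff _ P q.1).2 q.2⟩ := rfl

lemma residue_smul_toCotangent {S : Type*} [CommRing S] [IsLocalRing S] (a : S)
    (q : maximalIdeal S) : (maximalIdeal S).toCotangent (a • q) =
      (residue S a • (maximalIdeal S).toCotangent q : CotangentSpace S) := by
  rw [map_smul]
  exact (algebraMap_smul (ResidueField S) a
    ((maximalIdeal S).toCotangent q : CotangentSpace S)).symm

lemma cotangentClass_smul (a : MvPolynomial (Fin n) k) (q : P) :
    cotangentClass P (a • q) = algebraMap _ P.ResidueField a • cotangentClass P q := by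
  have h := residue_smul_toCotangent (algebraMap _ (Localization.AtPrime P) a)
    ⟨algebraMap _ _ q.1, (IsLocalization.AtPrime.to_map_mem_maximal_iff _ P q.1).2 q.2⟩
  rw [cotangentClass_apply, cotangentClass_apply]
  refine Eq.trans ?_ h
  congr 1
  exact Subtype.ext (map_mul _ _ _)

lemma linearIndependent_residueField_iff {V : Type*} [AddCommGroup V] [Module P.ResidueField V]
    {m : ℕ} (v : Fin m → V) : LinearIndependent P.ResidueField v ↔
      ∀ a : Fin m → MvPolynomial (Fin n) k,
        ∑ i, algebraMap _ P.ResidueField (a i) • v i = 0 → ∀ i, a i ∈ P := by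
  rw [Fintype.linearIndependent_iff]
  refine ⟨fun h a ha i => Ideal.algebraMap_residueField_eq_zero.1 (h _ ha i), fun h c hc => ?_⟩
  obtain ⟨b, hb⟩ := IsLocalization.exist_integer_multiples
    (nonZeroDivisors (MvPolynomial (Fin n) k ⧸ P)) Finset.univ c
  choose a ha using fun i => hb i (Finset.mem_univ i)
  choose a' ha' using fun i => Ideal.Quotient.mk_surjective (a i)
  have hb0 : algebraMap (MvPolynomial (Fin n) k ⧸ P) P.ResidueField b ≠ 0 :=
    IsLocalization.to_map_ne_zero_of_mem_nonZeroDivisors _ le_rfl b.2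
  have e : ∀ i, algebraMap _ P.ResidueField (a' i) =
      algebraMap (MvPolynomial (Fin n) k ⧸ P) P.ResidueField b * c i := by
    intro i
    rw [IsScalarTower.algebraMap_apply _ (MvPolynomial (Fin n) k ⧸ P),
      Ideal.Quotient.algebraMap_eq, ha', ha]
    exact Algebra.smul_def _ _
  have h1 := h a' (by simp only [e, mul_smul, ← Finset.smul_sum, hc, smul_zero])
  intro i
  have h2 := Ideal.algebraMap_residueField_eq_zero.2 (h1 i)
  rw [e] at h2
  exact (mul_eq_zero.1 h2).resolve_left hb0

lemma sum_smul_cotangentClass {m : ℕ} (g : Fin m → P) (a : Fin m → MvPolynomial (Fin n) k) :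
    ∑ i, algebraMap _ P.ResidueField (a i) • cotangentClass P (g i) =
      cotangentClass P (∑ i, a i • g i) := by
  simp only [map_sum, cotangentClass_smul]

lemma cotangentClass_eq_zero_iff [PerfectField k] (q : P) :
    cotangentClass P q = 0 ↔ residueGradient P q = 0 := by
  refine (Ideal.toCotangent_eq_zero _ _).trans ?_
  exact ⟨residueGradient_eq_zero_of_mem_sq P q.2, mem_sq_of_residueGradient_eq_zero P q.2⟩

lemma linearIndependent_cotangentClass_iff [PerfectField k] {m : ℕ} (g : Fin m → P) :
    LinearIndependent P.ResidueField (fun i => cotangentClass P (g i)) ↔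
      LinearIndependent P.ResidueField (fun i => residueGradient P (g i)) := by
  rw [linearIndependent_residueField_iff, linearIndependent_residueField_iff]
  refine forall_congr' fun a => imp_congr_left ?_
  rw [sum_smul_cotangentClass, cotangentClass_eq_zero_iff, AddSubmonoidClass.coe_finsetSum,
    map_sum]
  simp only [SetLike.val_smul, smul_eq_mul, residueGradient_mul_of_mem P _ (g _).2]

lemma finrank_cotangentSpace_eq_height :
    (Module.finrank P.ResidueField (CotangentSpace (Localization.AtPrime P)) : ℕ∞) = P.height := by
  have h := (IsRegularLocalRing.iff_finrank_cotangentSpace (Localization.AtPrime P)).1 inferInstance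
  rw [IsLocalization.AtPrime.ringKrullDim_eq_height P] at h
  exact_mod_cast h

lemma le_height_of_linearIndependent_residueGradient [PerfectField k] {m : ℕ} (g : Fin m → P)
    (hg : LinearIndependent P.ResidueField (fun i => residueGradient P (g i))) :
    (m : ℕ∞) ≤ P.height := by
  rw [← linearIndependent_cotangentClass_iff] at hg
  rw [← finrank_cotangentSpace_eq_height]
  have := hg.fintype_card_le_finrank
  rw [Fintype.card_fin] at this
  exact_mod_cast this

lemma exists_regular_parameters [PerfectField k] : ∃ (h : ℕ) (p : Fin h → P), (h : ℕ∞) = P.height ∧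
    LinearIndependent P.ResidueField (fun i => residueGradient P (p i)) ∧
    maximalIdeal (Localization.AtPrime P) =
      (Ideal.span (Set.range fun i => (p i : MvPolynomial (Fin n) k))).map (algebraMap _ _) := by
  set S := Localization.AtPrime P
  let b := Module.finBasis P.ResidueField (CotangentSpace S)
  choose m hm using fun i => (maximalIdeal S).toCotangent_surjective (b i)
  choose p hp using fun i => IsLocalization.surj P.primeCompl (m i).1
  have hpP : ∀ i, (p i).1 ∈ P := fun i => by
    rw [← IsLocalization.AtPrime.to_map_mem_maximal_iff S P, ← hp i]
    exact Ideal.mul_mem_right _ _ (m i).2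
  have hb : ∀ i, cotangentClass P ⟨(p i).1, hpP i⟩ =
      algebraMap _ P.ResidueField ((p i).2 : MvPolynomial (Fin n) k) • b i := by
    intro i
    have h := residue_smul_toCotangent (algebraMap _ S ((p i).2 : MvPolynomial (Fin n) k)) (m i)
    rw [hm] at h
    rw [cotangentClass_apply]
    refine Eq.trans ?_ h
    congr 1
    exact Subtype.ext ((hp i).symm.trans (mul_comm _ _))
  have hu : ∀ i, algebraMap _ P.ResidueField ((p i).2 : MvPolynomial (Fin n) k) ≠ 0 := fun i h =>
    (p i).2.2 (Ideal.algebraMap_residueField_eq_zero.1 h)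
  have hli : LinearIndependent P.ResidueField fun i => cotangentClass P ⟨(p i).1, hpP i⟩ := by
    have := b.linearIndependent.units_smul fun i => Units.mk0 _ (hu i)
    convert this using 1
    ext i
    exact hb i
  refine ⟨_, fun i => ⟨(p i).1, hpP i⟩, finrank_cotangentSpace_eq_height P,
    (linearIndependent_cotangentClass_iff P _).1 hli, ?_⟩
  have hspan := hli.span_eq_top_of_card_eq_finrank' (Fintype.card_fin _)
  let p' : Fin _ → maximalIdeal S := fun i => ⟨algebraMap _ S (p i).1,
    (IsLocalization.AtPrime.to_map_mem_maximal_iff S P _).2 (hpP i)⟩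
  have h2 : Submodule.span S (Set.range p') = ⊤ := by
    rw [← CotangentSpace.span_image_eq_top_iff, ← Set.range_comp]
    exact hspan
  have h3 := congrArg (Submodule.map (maximalIdeal S).subtype) h2
  rw [Submodule.map_span, Submodule.map_top, Submodule.range_subtype, ← Set.range_comp] at h3
  rw [Ideal.map_span, ← Set.range_comp]
  exact h3.symm

end Jacobian

section Jacobian
variable {k : Type} [Field k] {n : ℕ}
variable (P : Ideal (MvPolynomial (Fin n) k)) [P.IsPrime]

lemma exists_common_denominator {ι : Type*} [Finite ι] (c : ι → P.ResidueField) :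
    ∃ t ∉ P, ∃ a : ι → MvPolynomial (Fin n) k,
      ∀ i, algebraMap _ P.ResidueField (a i) = algebraMap _ P.ResidueField t * c i := by
  cases nonempty_fintype ι
  obtain ⟨b, hb⟩ := IsLocalization.exist_integer_multiples
    (nonZeroDivisors (MvPolynomial (Fin n) k ⧸ P)) Finset.univ c
  choose a ha using fun i => hb i (Finset.mem_univ i)
  choose a' ha' using fun i => Ideal.Quotient.mk_surjective (a i)
  obtain ⟨t, ht⟩ := Ideal.Quotient.mk_surjective (b : MvPolynomial (Fin n) k ⧸ P)
  have hb0 : algebraMap (MvPolynomial (Fin n) k ⧸ P) P.ResidueField b ≠ 0 :=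
    IsLocalization.to_map_ne_zero_of_mem_nonZeroDivisors _ le_rfl b.2
  have ht' : algebraMap _ P.ResidueField t =
      algebraMap (MvPolynomial (Fin n) k ⧸ P) P.ResidueField b := by
    rw [IsScalarTower.algebraMap_apply _ (MvPolynomial (Fin n) k ⧸ P),
      Ideal.Quotient.algebraMap_eq, ht]
  refine ⟨t, fun h => hb0 ?_, a', fun i => ?_⟩
  · rw [← ht', Ideal.algebraMap_residueField_eq_zero.2 h]
  · rw [ht', IsScalarTower.algebraMap_apply _ (MvPolynomial (Fin n) k ⧸ P),
      Ideal.Quotient.algebraMap_eq, ha', ha]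
    exact Algebra.smul_def _ _

lemma exists_eval_ne_zero_of_notMem [IsAlgClosed k] {w : MvPolynomial (Fin n) k} (hw : w ∉ P) :
    ∃ x : Fin n → k, (∀ q ∈ P, eval x q = 0) ∧ eval x w ≠ 0 := by
  rw [← MvPolynomial.IsPrime.vanishingIdeal_zeroLocus (K := k) P, mem_vanishingIdeal_iff] at hw
  push Not at hw
  obtain ⟨x, hx, hxw⟩ := hw
  exact ⟨x, fun q hq => by simpa [aeval_eq_eval] using mem_zeroLocus_iff.1 hx q hq,
    by simpa [aeval_eq_eval] using hxw⟩

/-- If the Jacobian matrix of homogeneous polynomials of degree `d` lying in a prime `P` is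
degenerate modulo `P`, then some nontrivial linear combination has Schmidt rank at most
`(d - 1) * P.height`. -/
lemma exists_polySchmidtRank_le_height [IsAlgClosed k] {d s : ℕ} (hd : 1 ≤ d)
    {f : Fin s → MvPolynomial (Fin n) k} (hhom : ∀ i, (f i).IsHomogeneous d) (hf : ∀ i, f i ∈ P)
    (hdeg : ¬ LinearIndependent P.ResidueField (fun i => residueGradient P (f i))) :
    ∃ γ : Fin s → k, γ ≠ 0 ∧ ∃ h : ℕ, (h : ℕ∞) = P.height ∧
      polySchmidtRank (∑ i, γ i • f i) ≤ h * (d - 1) := by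
  obtain ⟨h, p, hh, hp, hM⟩ := exists_regular_parameters P
  rw [linearIndependent_residueField_iff] at hdeg
  push Not at hdeg
  obtain ⟨c, hc, i₀, hi₀⟩ := hdeg
  have hc' : ∀ l, ∑ i, c i * pderiv l (f i) ∈ P := by
    intro l
    rw [← Ideal.algebraMap_residueField_eq_zero (I := P), map_sum]
    simpa [residueGradient, Algebra.smul_def] using congrFun hc l
  -- express the `f i` through the parameters
  have hur : ∀ i, ∃ u ∉ P, ∃ r : Fin h → MvPolynomial (Fin n) k,
      u * f i = ∑ j, r j * (p j : MvPolynomial (Fin n) k) := by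
    intro i
    have h1 := (IsLocalization.AtPrime.to_map_mem_maximal_iff (Localization.AtPrime P) P _).2 (hf i)
    rw [hM, IsLocalization.algebraMap_mem_map_algebraMap_iff P.primeCompl] at h1
    obtain ⟨u, hu, hu'⟩ := h1
    obtain ⟨r, hr⟩ := (Submodule.mem_span_range_iff_exists_fun _).1 hu'
    exact ⟨u, hu, r, hr.symm⟩
  choose u' hu' r' hr' using hur
  set u := ∏ i, u' i with hu
  have huP : u ∉ P := fun h => by
    obtain ⟨i, -, hi⟩ := (Ideal.IsPrime.prod_mem_iff).1 h
    exact hu' i hi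
  have hr : ∀ i, ∃ r : Fin h → MvPolynomial (Fin n) k,
      u * f i = ∑ j, (p j : MvPolynomial (Fin n) k) * r j := by
    intro i
    obtain ⟨v, hv⟩ : u' i ∣ u := Finset.dvd_prod_of_mem _ (Finset.mem_univ i)
    refine ⟨fun j => v * r' i j, ?_⟩
    rw [hv, mul_right_comm, hr', Finset.sum_mul]
    exact Finset.sum_congr rfl fun j _ => by ring
  choose r hr using hr
  -- invert the Jacobian matrix of the parameters
  obtain ⟨g, hg⟩ : ∃ g : (Fin n → P.ResidueField) →ₗ[P.ResidueField] (Fin h → P.ResidueField),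
      ∀ j, g (residueGradient P (p j)) = Pi.single j 1 := by
    obtain ⟨g, hg⟩ := (Fintype.linearCombination P.ResidueField
      (fun i => residueGradient P (p i))).exists_leftInverse_of_injective
      (LinearMap.ker_eq_bot.2 hp.fintypeLinearCombination_injective)
    refine ⟨g, fun j => ?_⟩
    have := congrArg (fun φ => φ (Pi.single j 1)) hg
    simpa [Fintype.linearCombination_apply_single] using this
  obtain ⟨t, ht, N, hN⟩ := exists_common_denominator P
    (fun x : Fin n × Fin h => g (Pi.single x.1 1) x.2)
  have hN' : ∀ j j', ∑ l, pderiv l (p j : MvPolynomial (Fin n) k) * N (l, j') -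
      (if j = j' then t else 0) ∈ P := by
    intro j j'
    rw [← Ideal.algebraMap_residueField_eq_zero (I := P), map_sub, map_sum]
    have h1 := congrFun (hg j) j'
    rw [← (Pi.basisFun P.ResidueField (Fin n)).sum_repr (residueGradient P (p j)), map_sum,
      Finset.sum_apply] at h1
    simp only [map_smul, Pi.basisFun_repr, Pi.basisFun_apply, Pi.smul_apply, smul_eq_mul] at h1
    have h2 : ∑ l, algebraMap _ P.ResidueField (pderiv l (p j : MvPolynomial (Fin n) k) * N (l, j')) =
        algebraMap _ P.ResidueField t * (Pi.single j 1 : Fin h → P.ResidueField) j' := by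
      rw [← h1, Finset.mul_sum]
      refine Finset.sum_congr rfl fun l _ => ?_
      rw [map_mul, hN]
      simp only [residueGradient, AddMonoidHom.coe_mk, ZeroHom.coe_mk]
      ring
    rw [h2, Pi.single_apply]
    by_cases hj : j = j'
    · simp [hj]
    · simp [hj, Ne.symm hj]
  -- specialize to a point
  obtain ⟨x, hxP, hx⟩ := exists_eval_ne_zero_of_notMem P (w := u * t * c i₀)
    (by simp only [Ideal.IsPrime.mul_mem_iff_mem_or_mem]; tauto)
  simp only [map_mul, mul_ne_zero_iff] at hx
  obtain ⟨⟨hxu, hxt⟩, hxc⟩ := hx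
  refine ⟨fun i => eval x (c i), fun h0 => hxc (congrFun h0 i₀), h, hh, ?_⟩
  set F := ∑ i, eval x (c i) • f i with hF
  set R : Fin h → MvPolynomial (Fin n) k := fun j => ∑ i, eval x (c i) • r i j with hR
  have hFhom : F.IsHomogeneous d := IsHomogeneous.sum _ _ _ fun i _ =>
    (mem_homogeneousSubmodule _ _).1 (Submodule.smul_mem _ _ (hhom i))
  have huF : u * F = ∑ j, (p j : MvPolynomial (Fin n) k) * R j := by
    simp only [hF, hR, Finset.mul_sum, mul_smul_comm, hr, Finset.smul_sum]
    rw [Finset.sum_comm]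
  have hFx : eval x F = 0 := hxP _ (P.sum_mem fun i _ => by
    rw [smul_eq_C_mul]; exact P.mul_mem_left _ (hf i))
  have hdF : ∀ l, eval x (pderiv l F) = 0 := by
    intro l
    rw [← hxP _ (hc' l), hF]
    simp [map_sum, smul_eval]
  have hsum : ∀ l, ∑ j, eval x (R j) * eval x (pderiv l (p j : MvPolynomial (Fin n) k)) = 0 := by
    intro l
    have h1 := congrArg (fun q => eval x (pderiv l q)) huF
    simp only [map_sum, Derivation.leibniz, smul_eq_mul, map_add, map_mul, hFx, hdF,
      hxP _ (p _).2, zero_mul, mul_zero, zero_add] at h1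
    exact h1.symm
  refine polySchmidtRank_le_of_mul_eq_sum hd hFhom x hxu (fun j => hxP _ (p j).2) (fun j' => ?_) huF
  have h2 : ∑ l, (∑ j, eval x (R j) * eval x (pderiv l (p j : MvPolynomial (Fin n) k))) *
      eval x (N (l, j')) = 0 := Finset.sum_eq_zero fun l _ => by rw [hsum, zero_mul]
  simp only [Finset.sum_mul] at h2
  rw [Finset.sum_comm] at h2
  have h3 : ∀ j, ∑ l, eval x (R j) * eval x (pderiv l (p j : MvPolynomial (Fin n) k)) *
      eval x (N (l, j')) = eval x (R j) * if j = j' then eval x t else 0 := by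
    intro j
    have h4 := hxP _ (hN' j j')
    rw [map_sub, map_sum, sub_eq_zero, apply_ite (eval x), map_zero] at h4
    rw [← h4, Finset.mul_sum]
    exact Finset.sum_congr rfl fun l _ => by rw [map_mul]; ring
  simp only [h3, mul_ite, mul_zero, Finset.sum_ite_eq', Finset.mem_univ, if_true] at h2
  exact (mul_eq_zero.1 h2).resolve_right hxt

end Jacobian

lemma ringKrullDim_quotient_add_le_of_le_height {A : Type*} [CommRing A] (I : Ideal A) (s : ℕ)
    (h : ∀ P : Ideal A, P.IsPrime → I ≤ P → (s : ℕ∞) ≤ P.height) :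
    ringKrullDim (A ⧸ I) + s ≤ ringKrullDim A := by
  have key : ∀ p : LTSeries (PrimeSpectrum (A ⧸ I)),
      (p.length : WithBot ℕ∞) + s ≤ ringKrullDim A := by
    intro p
    let q : LTSeries (PrimeSpectrum A) := p.map (PrimeSpectrum.comap (Ideal.Quotient.mk I))
      (Monotone.strictMono_of_injective (fun a b hab => Ideal.comap_mono hab)
        (PrimeSpectrum.comap_injective_of_surjective _ Ideal.Quotient.mk_surjective))
    have hq : I ≤ q.head.asIdeal := by
      intro x hx
      simp [q, LTSeries.head_map, Ideal.Quotient.eq_zero_iff_mem.2 hx]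
    have h1 := h _ q.head.2 hq
    rw [PrimeSpectrum.height_eq_orderHeight] at h1
    obtain ⟨r, hr, hrl⟩ := Order.exists_series_of_le_height _ h1
    have h2 := Order.LTSeries.length_le_krullDim (r.smash q hr)
    simp only [RelSeries.smash_length, hrl] at h2
    rw [add_comm]
    exact_mod_cast h2
  rcases isEmpty_or_nonempty (LTSeries (PrimeSpectrum (A ⧸ I))) with he | he
  · have : ringKrullDim (A ⧸ I) = ⊥ := by simp [ringKrullDim, Order.krullDim]
    simp [this]
  · have : Nonempty (PrimeSpectrum (A ⧸ I)) := ⟨he.some.head⟩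
    rcases finiteDimensionalOrder_or_infiniteDimensionalOrder (PrimeSpectrum (A ⧸ I)) with hf | hi
    · rw [ringKrullDim, Order.krullDim_eq_length_of_finiteDimensionalOrder]
      exact key _
    · have htop : ringKrullDim A = ⊤ := by
        by_contra hne
        have hbot : ringKrullDim A ≠ ⊥ := fun hb => by
          simpa [hb] using key he.some
        obtain ⟨m, hm⟩ : ∃ m : ℕ, ringKrullDim A = m := by
          generalize ringKrullDim A = D at hne hbot
          induction D with
          | bot => exact absurd rfl hbot
          | coe D =>
            lift D to ℕ using by rintro rfl; exact hne rfl
            exact ⟨D, rfl⟩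
        have := key (LTSeries.withLength _ (m + 1))
        rw [hm, LTSeries.length_withLength] at this
        have : m + 1 + s ≤ m := by exact_mod_cast this
        omega
      rw [htop]
      exact le_top

section
variable {k : Type} [Field k] {n : ℕ}

lemma linearIndependent_residueGradient_of_height_le [IsAlgClosed k] {d s m : ℕ} (hd : 1 ≤ d)
    {f : Fin s → MvPolynomial (Fin n) k} (hhom : ∀ i, (f i).IsHomogeneous d)
    (hrank : ∀ c : Fin s → k, c ≠ 0 → m * (d - 1) < polySchmidtRank (∑ i, c i • f i))
    (P : Ideal (MvPolynomial (Fin n) k)) [P.IsPrime] (hf : ∀ i, f i ∈ P) (hm : P.height ≤ m) :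
    LinearIndependent P.ResidueField (fun i => residueGradient P (f i)) := by
  by_contra hdeg
  obtain ⟨γ, hγ, h, hh, hle⟩ := exists_polySchmidtRank_le_height P hd hhom hf hdeg
  have h1 : h ≤ m := by rw [← hh] at hm; exact_mod_cast hm
  have := Nat.mul_le_mul_right (d - 1) h1
  have := hrank γ hγ
  omega

lemma le_height_of_lt_polySchmidtRank [IsAlgClosed k] {d s : ℕ} (hd : 1 ≤ d)
    {f : Fin s → MvPolynomial (Fin n) k} (hhom : ∀ i, (f i).IsHomogeneous d)
    (hrank : ∀ c : Fin s → k, c ≠ 0 → (s - 1) * (d - 1) < polySchmidtRank (∑ i, c i • f i))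
    (P : Ideal (MvPolynomial (Fin n) k)) [P.IsPrime] (hf : ∀ i, f i ∈ P) :
    (s : ℕ∞) ≤ P.height := by
  by_contra h
  push Not at h
  have h1 : P.height ≤ (s - 1 : ℕ) := by
    lift P.height to ℕ using h.ne_top with m
    have : m < s := by exact_mod_cast h
    exact_mod_cast (by omega : m ≤ s - 1)
  exact absurd (le_height_of_linearIndependent_residueGradient P (fun i => ⟨f i, hf i⟩)
    (linearIndependent_residueGradient_of_height_le hd hhom hrank P hf h1)) (not_le.2 h)

lemma card_le_height_ker_constantCoeff [IsAlgClosed k] :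
    (n : ℕ∞) ≤ (RingHom.ker (constantCoeff : MvPolynomial (Fin n) k →+* k)).height := by
  set P := RingHom.ker (constantCoeff : MvPolynomial (Fin n) k →+* k)
  have : P.IsPrime := RingHom.ker_isPrime _
  refine le_height_of_linearIndependent_residueGradient P (fun i => ⟨X i, by simp [P]⟩) ?_
  convert (Pi.basisFun P.ResidueField (Fin n)).linearIndependent using 2 with i
  ext l
  simp [residueGradient, pderiv_X, Pi.single_apply]
  exact if_congr eq_comm rfl rfl

lemma affineCodim_eq_of_lt_polySchmidtRank [IsAlgClosed k] {d s : ℕ} (hd : 1 ≤ d)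
    {f : Fin s → MvPolynomial (Fin n) k} (hhom : ∀ i, (f i).IsHomogeneous d)
    (hrank : ∀ c : Fin s → k, c ≠ 0 → (s - 1) * (d - 1) < polySchmidtRank (∑ i, c i • f i)) :
    affineCodim k (Ideal.span (Set.range f)) = (s : ℕ∞) := by
  set I := Ideal.span (Set.range f)
  set 𝔪 := RingHom.ker (constantCoeff : MvPolynomial (Fin n) k →+* k)
  have : 𝔪.IsPrime := RingHom.ker_isPrime _
  have hI : I ≤ 𝔪 := by
    rw [Ideal.span_le]
    rintro _ ⟨i, rfl⟩
    exact (hhom i).coeff_eq_zero (by simp; omega)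
  have h1 := ringKrullDim_quotient_add_le_of_le_height I s fun P hP hIP =>
    le_height_of_lt_polySchmidtRank hd hhom hrank P fun i =>
      hIP (Ideal.subset_span (Set.mem_range_self i))
  have h2 := Ideal.height_le_ringKrullDim_quotient_add_encard (p := 𝔪) (Set.range f)
    (fun x hx => hI (Ideal.subset_span hx))
  have h3 : (n : ℕ∞) ≤ 𝔪.height := card_le_height_ker_constantCoeff
  have h4 : (Set.range f).encard ≤ s := by
    rw [← Set.image_univ]
    exact (Set.encard_image_le _ _).trans (by simp)
  have h5 : ringKrullDim (MvPolynomial (Fin n) k) = n := by simp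
  have h6 : (n : WithBot ℕ∞) ≤ ringKrullDim (MvPolynomial (Fin n) k ⧸ I) + s := by
    refine le_trans (by exact_mod_cast h3) (h2.trans ?_)
    gcongr
    exact_mod_cast h4
  rw [h5] at h1
  rw [affineCodim, affineDim]
  revert h1 h6
  generalize ringKrullDim (MvPolynomial (Fin n) k ⧸ I) = D
  intro h1 h6
  induction D with
  | bot => simp at h6
  | coe D =>
    have h7 : D + s ≤ (n : ℕ∞) := by exact_mod_cast h1
    have h8 : (n : ℕ∞) ≤ D + s := by exact_mod_cast h6
    lift D to ℕ using by rintro rfl; simp at h7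
    simp only [WithBot.recBotCoe_coe, Fintype.card_fin]
    have h9 : D + s = n := by exact_mod_cast le_antisymm h7 h8
    have h10 : (n : ℕ∞) - (D : ℕ∞) = (s : ℕ∞) := by
      rw [← ENat.natCast_sub]
      exact_mod_cast (by omega : n - D = s)
    exact h10

end

namespace RingTheory.Sequence
open CategoryTheory Abelian ModuleCat
universe u
variable {S : Type u} [CommRing S] [IsNoetherianRing S]

lemma IsWeaklyRegular.exists_isSMulRegular_quotient {I : Ideal S} {rs : List S} {M : ModuleCat.{u} S}
    [Module.Finite S M] (hreg : IsWeaklyRegular M rs)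
    (hext : ∀ i ≤ rs.length, Subsingleton (Ext (ModuleCat.of S (S ⧸ I)) M i)) :
    ∃ x ∈ I, IsSMulRegular (M ⧸ (Ideal.ofList rs • ⊤ : Submodule S M)) x := by
  induction rs generalizing M with
  | nil =>
    have h0 : Subsingleton (ModuleCat.of S (S ⧸ I) ⟶ M) :=
      Ext.addEquiv₀.subsingleton_congr.mp (hext 0 le_rfl)
    have : Subsingleton (ModuleCat.of S (S ⧸ I) →ₗ[S] M) :=
      ModuleCat.homAddEquiv.symm.subsingleton
    obtain ⟨x, hx, hxM⟩ := IsSMulRegular.subsingleton_linearMap_iff.mp this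
    rw [Ideal.annihilator_quotient] at hx
    refine ⟨x, hx, ?_⟩
    rw [Ideal.ofList_nil, Submodule.bot_smul]
    exact ((Submodule.quotEquivOfEqBot (⊥ : Submodule S M) rfl).isSMulRegular_congr x).2 hxM
  | cons a rs ih =>
    rw [isWeaklyRegular_cons_iff] at hreg
    have h1 : ∀ i ≤ rs.length,
        Subsingleton (Ext (ModuleCat.of S (S ⧸ I)) (ModuleCat.of S (QuotSMulTop a M)) i) := by
      intro i hi
      have zero1 := AddCommGrpCat.isZero_of_iff_subsingleton.mpr (hext i (by simp; omega))
      have zero2 := AddCommGrpCat.isZero_of_iff_subsingleton.mpr (hext (i + 1) (by simp; omega))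
      exact AddCommGrpCat.subsingleton_of_isZero <| ShortComplex.Exact.isZero_of_both_zeros
        ((Ext.covariant_sequence_exact₃' _ hreg.1.smulShortComplex_shortExact) i (i + 1) rfl)
        (zero1.eq_zero_of_src _) (zero2.eq_zero_of_tgt _)
    obtain ⟨x, hx, hxM⟩ := ih (M := ModuleCat.of S (QuotSMulTop a M)) hreg.2 h1
    exact ⟨x, hx, ((Submodule.quotOfListConsSMulTopEquivQuotSMulTopInner M a rs).isSMulRegular_congr
      x).2 hxM⟩

end RingTheory.Sequence

namespace IsLocalRing
variable {S : Type*} [CommRing S] [IsLocalRing S] [IsNoetherianRing S]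

lemma exists_maximalIdeal_eq_span_union {m e : ℕ}
    (he : Module.finrank (ResidueField S) (CotangentSpace S) = m + e) (g : Fin m → maximalIdeal S)
    (hg : LinearIndependent (ResidueField S) fun i => (maximalIdeal S).toCotangent (g i)) :
    ∃ z : Fin e → S, maximalIdeal S =
      Ideal.span (Set.range (fun i => (g i : S)) ∪ Set.range z) := by
  set W := Submodule.span (ResidueField S)
    (Set.range fun i => (maximalIdeal S).toCotangent (g i)) with hW
  have hWd : Module.finrank (ResidueField S) W = m := by
    simpa using finrank_span_eq_card hg
  have hQ : Module.finrank (ResidueField S) (CotangentSpace S ⧸ W) = e := by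
    have := W.finrank_quotient_add_finrank
    rw [hWd] at this
    exact Nat.add_right_cancel (this.trans (he.trans (add_comm _ _)))
  let b := Module.finBasisOfFinrankEq _ _ hQ
  choose c hc using fun i => W.mkQ_surjective (b i)
  choose z hz using fun i => (maximalIdeal S).toCotangent_surjective (c i)
  refine ⟨fun i => z i, ?_⟩
  have htop : Submodule.span (ResidueField S)
      ((maximalIdeal S).toCotangent '' (Set.range g ∪ Set.range z)) = ⊤ := by
    rw [Set.image_union, ← Set.range_comp, ← Set.range_comp, Submodule.span_union]
    have h1 : Submodule.map W.mkQ (Submodule.span (ResidueField S)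
        (Set.range ((maximalIdeal S).toCotangent ∘ z))) = ⊤ := by
      rw [Submodule.map_span, ← Set.range_comp, ← b.span_eq]
      congr 2
      ext i
      simp [hz, ← hc]
    have h2 := Submodule.comap_map_eq W.mkQ (Submodule.span (ResidueField S)
        (Set.range ((maximalIdeal S).toCotangent ∘ z)))
    rw [h1, Submodule.ker_mkQ, Submodule.comap_top, sup_comm] at h2
    exact h2.symm
  rw [CotangentSpace.span_image_eq_top_iff] at htop
  have := congrArg (Submodule.map (maximalIdeal S).subtype) htop
  rw [Submodule.map_span, Submodule.map_top, Submodule.range_subtype, Set.image_union,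
    ← Set.range_comp, ← Set.range_comp] at this
  exact this.symm

end IsLocalRing

namespace IsRegularLocalRing
variable {S : Type*} [CommRing S]

/-- The quotient of a regular local ring by part of a regular system of parameters is regular. -/
lemma quotient_span_range [IsRegularLocalRing S] {m e : ℕ}
    (he : Module.finrank (ResidueField S) (CotangentSpace S) = m + e) (g : Fin m → maximalIdeal S)
    (hg : LinearIndependent (ResidueField S) fun i => (maximalIdeal S).toCotangent (g i)) :
    IsRegularLocalRing (S ⧸ Ideal.span (Set.range fun i => (g i : S))) ∧
      ringKrullDim (S ⧸ Ideal.span (Set.range fun i => (g i : S))) = e := by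
  obtain ⟨z, hz⟩ := exists_maximalIdeal_eq_span_union he g hg
  have hle : Ideal.span (Set.range fun i => (g i : S)) ≤ maximalIdeal S := by
    rw [Ideal.span_le]; rintro _ ⟨i, rfl⟩; exact (g i).2
  have hdim : ringKrullDim S = (m + e : ℕ) := by
    rw [← (iff_finrank_cotangentSpace S).1 ‹_›, he]
  generalize hI : Ideal.span (Set.range fun i => (g i : S)) = I at hle
  have : Nontrivial (S ⧸ I) :=
    Ideal.Quotient.nontrivial_iff.2 fun h => (maximalIdeal.isMaximal S).ne_top (top_le_iff.1 (h ▸ hle))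
  have : IsLocalRing (S ⧸ I) := .of_surjective' _ Ideal.Quotient.mk_surjective
  have h1 : (maximalIdeal (S ⧸ I)).spanFinrank ≤ e := by
    have h2 : maximalIdeal (S ⧸ I) = Ideal.span (Set.range fun i => Ideal.Quotient.mk I (z i)) := by
      rw [← map_maximalIdeal_of_surjective _ Ideal.Quotient.mk_surjective, hz, Ideal.span_union,
        hI, Ideal.map_sup, Ideal.map_quotient_self, bot_sup_eq, Ideal.map_span, ← Set.range_comp]
      rfl
    rw [h2]
    refine (Submodule.spanFinrank_span_le_ncard_of_finite (Set.finite_range _)).trans ?_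
    rw [← Set.image_univ]
    exact (Set.ncard_image_le (Set.toFinite _)).trans (by simp)
  have h2 : (e : WithBot ℕ∞) ≤ ringKrullDim (S ⧸ I) := by
    have h4 := Ideal.height_le_ringKrullDim_quotient_add_encard (p := maximalIdeal S)
      (Set.range fun i => (g i : S)) (by rintro _ ⟨i, rfl⟩; exact (g i).2)
    have h5 : (Set.range fun i => (g i : S)).encard ≤ m := by
      rw [← Set.image_univ]
      exact (Set.encard_image_le _ _).trans (by simp)
    rw [maximalIdeal_height_eq_ringKrullDim, hdim, hI] at h4
    revert h4
    generalize ringKrullDim (S ⧸ I) = D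
    intro h4
    induction D with
    | bot => simp at h4
    | coe D =>
      have h6 : ((m + e : ℕ) : ℕ∞) ≤ D + (Set.range fun i => (g i : S)).encard := by
        exact_mod_cast h4
      have h7 : (e : ℕ∞) + m ≤ D + m := by
        refine le_trans (le_of_eq ?_) (h6.trans (by gcongr))
        rw [add_comm]; norm_cast
      exact_mod_cast (ENat.add_le_add_iff_right (ENat.natCast_ne_top m)).1 h7
  have h3 : IsRegularLocalRing (S ⧸ I) :=
    of_spanFinrank_maximalIdeal_le _ (le_trans (by exact_mod_cast h1) h2)
  refine ⟨h3, le_antisymm ?_ h2⟩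
  rw [← h3.spanFinrank_maximalIdeal]
  exact_mod_cast h1

/-- Cutting a regular local ring of positive dimension by a suitable parameter. -/
lemma exists_quotient_span_singleton [IsRegularLocalRing S] {h : ℕ}
    (hdim : ringKrullDim S = (h + 1 : ℕ)) :
    ∃ x ∈ maximalIdeal S, (∀ P ∈ minimalPrimes S, x ∉ P) ∧
      IsRegularLocalRing (S ⧸ Ideal.span {x}) ∧ ringKrullDim (S ⧸ Ideal.span {x}) = h := by
  have hfin := (iff_finrank_cotangentSpace S).1 ‹_›
  rw [hdim] at hfin
  have hfin' : Module.finrank (ResidueField S) (CotangentSpace S) = 1 + h := by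
    rw [add_comm]; exact_mod_cast hfin
  obtain ⟨x, hxM, hx⟩ : ∃ x ∈ maximalIdeal S, x ∉ (maximalIdeal S) ^ 2 ∧
      ∀ P ∈ minimalPrimes S, x ∉ P := by
    by_contra! hcon
    have hsub : (maximalIdeal S : Set S) ⊆
        ⋃ I ∈ insert ((maximalIdeal S) ^ 2) (minimalPrimes S), (I : Set S) := by
      intro x hx
      by_cases h2 : x ∈ (maximalIdeal S) ^ 2
      · exact Set.mem_biUnion (Set.mem_insert _ _) h2
      · obtain ⟨P, hP, hxP⟩ := hcon x hx h2
        exact Set.mem_biUnion (Set.mem_insert_of_mem _ hP) hxP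
    rw [Ideal.subset_union_prime_finite ((minimalPrimes.finite_of_isNoetherianRing S).insert _)
      (f := fun I : Ideal S => I) ((maximalIdeal S) ^ 2) ((maximalIdeal S) ^ 2)
      (fun I hI h2 _ => (hI.resolve_left h2).isPrime)] at hsub
    obtain ⟨I, rfl | hI, hle⟩ := hsub
    · have h0 : maximalIdeal S = ⊥ := by
        refine Submodule.eq_bot_of_le_smul_of_le_jacobson_bot (maximalIdeal S) _
          (IsNoetherian.noetherian _) (by rwa [smul_eq_mul, ← sq])
          (IsLocalRing.maximalIdeal_le_jacobson _)
      have := ringKrullDim_le_spanFinrank_maximalIdeal S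
      rw [h0, hdim] at this
      simp at this
    · have h0 : maximalIdeal S = I :=
        (maximalIdeal.isMaximal S).eq_of_le hI.isPrime.ne_top hle
      have h1 : (maximalIdeal S).height = 0 := by
        have := hI.isPrime
        rw [h0, Ideal.height_eq_zero_iff]; exact hI
      have h2 := maximalIdeal_height_eq_ringKrullDim (R := S)
      rw [h1, hdim] at h2
      have : (0 : ℕ) = h + 1 := by exact_mod_cast h2
      omega
  refine ⟨x, hxM, hx.2, ?_⟩
  have := quotient_span_range hfin' (fun _ : Fin 1 => ⟨x, hxM⟩) (by
    rw [linearIndependent_unique_iff, Ne, Ideal.toCotangent_eq_zero]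
    exact hx.1)
  rwa [Set.range_const] at this

universe u

lemma isDomain_and_exists_isWeaklyRegular (h : ℕ) (S : Type u) [CommRing S] [IsRegularLocalRing S]
    (hdim : ringKrullDim S = h) :
    IsDomain S ∧ ∃ rs : List S, rs.length = h ∧ (∀ r ∈ rs, r ∈ maximalIdeal S) ∧
      RingTheory.Sequence.IsWeaklyRegular S rs := by
  induction h generalizing S with
  | zero =>
    refine ⟨?_, [], rfl, by simp, .nil S S⟩
    have h0 : (maximalIdeal S).spanFinrank = 0 := by
      have := IsRegularLocalRing.spanFinrank_maximalIdeal (R := S)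
      rw [hdim] at this
      exact_mod_cast this
    rw [Submodule.spanFinrank_eq_zero_iff_eq_bot (IsNoetherian.noetherian _)] at h0
    exact (IsLocalRing.isField_iff_maximalIdeal_eq.2 h0).isDomain
  | succ h ih =>
    obtain ⟨x, hxM, hmin, hreg, hdim'⟩ := exists_quotient_span_singleton hdim
    obtain ⟨hdom, rs, hlen, hmem, hrs⟩ := ih (S ⧸ Ideal.span {x}) hdim'
    have hprime : (Ideal.span {x}).IsPrime := (Ideal.Quotient.isDomain_iff_prime _).1 hdom
    have hS : IsDomain S := by
      obtain ⟨P, hP, hle⟩ := Ideal.exists_minimalPrimes_le (bot_le : ⊥ ≤ Ideal.span {x})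
      have hPp := hP.isPrime
      have h0 : P = ⊥ := by
        refine Submodule.eq_bot_of_le_smul_of_le_jacobson_bot (maximalIdeal S) _
          (IsNoetherian.noetherian _) (fun y hy => ?_) (IsLocalRing.maximalIdeal_le_jacobson _)
        obtain ⟨a, rfl⟩ := Ideal.mem_span_singleton.1 (hle hy)
        exact Ideal.mul_mem_mul hxM ((hPp.mem_or_mem hy).resolve_left (hmin P hP))
      rw [h0] at hPp
      exact IsDomain.of_bot_isPrime S
    refine ⟨hS, ?_⟩
    have hx0 : x ≠ 0 := by
      rintro rfl
      obtain ⟨P, hP, -⟩ := Ideal.exists_minimalPrimes_le (bot_le : ⊥ ≤ maximalIdeal S)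
      exact hmin P hP P.zero_mem
    obtain ⟨ts, rfl⟩ := List.map_surjective_iff.2 Ideal.Quotient.mk_surjective rs
    refine ⟨x :: ts, by simpa using hlen, ?_, ?_⟩
    · intro r hr
      rcases List.mem_cons.1 hr with rfl | hr
      · exact hxM
      · have := hmem _ (List.mem_map_of_mem hr)
        by_contra hunit
        exact this ((not_not.1 hunit : IsUnit r).map _)
    · rw [RingTheory.Sequence.isWeaklyRegular_cons_iff]
      refine ⟨fun _ _ hab => mul_left_cancel₀ hx0 hab, ?_⟩
      have := (RingTheory.Sequence.isWeaklyRegular_map_algebraMap_iff (S ⧸ Ideal.span {x})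
        (S ⧸ Ideal.span {x}) ts).1 hrs
      refine (LinearEquiv.isWeaklyRegular_congr (Submodule.quotEquivOfEq _ _ ?_) ts).1 this
      rw [← Submodule.ideal_span_singleton_smul]
      simp

/-- Unmixedness in a regular local ring: an ideal generated by a weakly regular sequence shorter
than the dimension admits a nonzerodivisor modulo it in the maximal ideal. -/
lemma exists_isSMulRegular_of_length_lt {S : Type u} [CommRing S] [IsRegularLocalRing S]
    {rs : List S} (hrs : RingTheory.Sequence.IsWeaklyRegular S rs)
    (hlt : (rs.length : WithBot ℕ∞) < ringKrullDim S) :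
    ∃ x ∈ maximalIdeal S, ∀ a, x * a ∈ Ideal.ofList rs → a ∈ Ideal.ofList rs := by
  obtain ⟨h, hh⟩ : ∃ h : ℕ, ringKrullDim S = h :=
    ⟨_, (IsRegularLocalRing.spanFinrank_maximalIdeal (R := S)).symm⟩
  obtain ⟨-, ts, hlen, hmem, hts⟩ := isDomain_and_exists_isWeaklyRegular h S hh
  have hlt' : rs.length < h := by rw [hh] at hlt; exact_mod_cast hlt
  have hreg : RingTheory.Sequence.IsRegular S ts :=
    .of_isWeaklyRegular_of_mem_maximalIdeal S hmem hts
  have htop : maximalIdeal S • (⊤ : Submodule S S) < ⊤ := by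
    rw [smul_eq_mul, Ideal.mul_top]
    exact (maximalIdeal.isMaximal S).ne_top.lt_top
  have hext := ModuleCat.subsingleton_ext_of_exists_isRegular (maximalIdeal S)
    (ModuleCat.of S (S ⧸ maximalIdeal S))
    (by rw [Module.support_eq_zeroLocus, Ideal.annihilator_quotient])
    (ModuleCat.of S S) htop ts hmem hreg
  obtain ⟨x, hx, hxr⟩ := RingTheory.Sequence.IsWeaklyRegular.exists_isSMulRegular_quotient
    (I := maximalIdeal S) (M := ModuleCat.of S S) hrs fun i hi => hext i (by omega)
  refine ⟨x, hx, fun a ha => ?_⟩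
  have heq : (Ideal.ofList rs • ⊤ : Submodule S S) = Ideal.ofList rs := by simp
  change IsSMulRegular (S ⧸ (Ideal.ofList rs • ⊤ : Submodule S S)) x at hxr
  rw [heq] at hxr
  have h0 : x • (Submodule.Quotient.mk a : S ⧸ Ideal.ofList rs) = 0 := by
    rw [← Submodule.Quotient.mk_smul, Submodule.Quotient.mk_eq_zero]
    exact ha
  exact (Submodule.Quotient.mk_eq_zero _).1 (hxr.right_eq_zero_of_smul h0)

end IsRegularLocalRing

lemma Ideal.exists_isAssociatedPrime_of_notMem {B : Type*} [CommRing B] [IsNoetherianRing B]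
    {J : Ideal B} {a : B} (ha : a ∉ J) :
    ∃ P : Ideal B, J.IsAssociatedPrime P ∧ ∀ r, r * a ∈ J → r ∈ P := by
  have hcolon : ∀ b : B, (⊥ : Submodule B (B ⧸ J)).colon {(Ideal.Quotient.mk J b : B ⧸ J)} =
      Submodule.colon J {b} := fun b => by
    ext r
    rw [Submodule.mem_colon_singleton, Submodule.mem_colon_singleton, Submodule.mem_bot,
      ← Ideal.Quotient.eq_zero_iff_mem]
    rfl
  obtain ⟨P, hP, hle⟩ := exists_le_isAssociatedPrime_of_isNoetherianRing B
    (Ideal.Quotient.mk J a) fun h => ha (Ideal.Quotient.eq_zero_iff_mem.1 h)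
  rw [isAssociatedPrime_iff] at hP
  obtain ⟨hprime, x, hx⟩ := hP
  obtain ⟨b, rfl⟩ := Ideal.Quotient.mk_surjective x
  refine ⟨P, Submodule.isAssociatedPrime_iff.2 ⟨hprime, b, hx.trans (hcolon b)⟩, fun r hr => ?_⟩
  exact hle (by rw [hcolon, Submodule.mem_colon_singleton]; exact hr)

lemma Submodule.IsAssociatedPrime.exists_mem_iff {B : Type*} [CommRing B] [IsNoetherianRing B]
    {J P : Ideal B} (h : J.IsAssociatedPrime P) : ∃ b, ∀ r, r ∈ P ↔ r * b ∈ J := by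
  obtain ⟨-, b, rfl⟩ := Submodule.isAssociatedPrime_iff.1 h
  exact ⟨b, fun r => Submodule.mem_colon_singleton⟩

lemma Ideal.mem_of_forall_isAssociatedPrime {B : Type*} [CommRing B] [IsNoetherianRing B]
    {J : Ideal B} {a : B}
    (h : ∀ P : Ideal B, J.IsAssociatedPrime P → ∃ u ∉ P, u * a ∈ J) : a ∈ J := by
  by_contra ha
  obtain ⟨P, hP, hle⟩ := Ideal.exists_isAssociatedPrime_of_notMem ha
  obtain ⟨u, hu, hua⟩ := h P hP
  exact hu (hle u hua)

lemma exists_mul_mem_span_singleton {B : Type*} [CommRing B] {c a : B} (P : Ideal B)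
    [P.IsPrime] {y : Localization.AtPrime P}
    (h : algebraMap B _ a = algebraMap B _ c * y) : ∃ u ∉ P, u * a ∈ Ideal.span {c} := by
  obtain ⟨⟨e, u⟩, hu⟩ := IsLocalization.surj P.primeCompl y
  simp only at hu
  have h1 : algebraMap B (Localization.AtPrime P) (a * u) = algebraMap B _ (c * e) := by
    rw [map_mul, map_mul, h, mul_assoc, hu]
  obtain ⟨v, hv⟩ := (IsLocalization.eq_iff_exists P.primeCompl _).1 h1
  refine ⟨v * u, (v * u).2, Ideal.mem_span_singleton.2 ⟨v * e, ?_⟩⟩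
  linear_combination hv

lemma IsLocalRing.isDomain_of_isAssociatedPrime {B : Type*} [CommRing B] [IsLocalRing B]
    [IsNoetherianRing B]
    (h0 : ∀ (P : Ideal B) [P.IsPrime], (⊥ : Ideal B).IsAssociatedPrime P →
      IsDomain (Localization.AtPrime P))
    (h1 : ∀ c ∈ nonZeroDivisors B, ∀ (P : Ideal B) [P.IsPrime],
      (Ideal.span {c}).IsAssociatedPrime P → IsDomain (Localization.AtPrime P)) :
    IsDomain B := by
  have : NoZeroDivisors B := by
    refine ⟨fun {x y} hxy => ?_⟩
    by_contra! hne
    obtain ⟨hx, hy⟩ := hne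
    set N := LinearMap.ker (LinearMap.mulLeft B x) with hN
    have hNmem : ∀ b, b ∈ N ↔ x * b = 0 := fun b => by simp [hN]
    have hNP : ∀ P : Ideal B, (⊥ : Ideal B).IsAssociatedPrime P → x ∈ P → ¬ N ≤ P := by
      intro P hP hxP hle
      have hPp := hP.1
      have := h0 P hP
      obtain ⟨w, hw⟩ := hP.exists_mem_iff
      have hw0 : algebraMap B (Localization.AtPrime P) w ≠ 0 := fun h => by
        obtain ⟨u, hu⟩ := (IsLocalization.map_eq_zero_iff P.primeCompl _ _).1 h
        exact u.2 ((hw u).2 (by simp [hu]))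
      have hx0 : algebraMap B (Localization.AtPrime P) x = 0 := by
        refine (mul_eq_zero.1 ?_).resolve_right hw0
        rw [← map_mul, (by simpa using (hw x).1 hxP : x * w = 0), map_zero]
      obtain ⟨u, hu⟩ := (IsLocalization.map_eq_zero_iff P.primeCompl _ _).1 hx0
      exact u.2 (hle ((hNmem _).2 (by rw [mul_comm]; exact hu)))
    obtain ⟨b, hbN, hb⟩ : ∃ b ∈ N, ∀ P : Ideal B, (⊥ : Ideal B).IsAssociatedPrime P →
        x ∈ P → b ∉ P := by
      by_contra! hcon
      have hfin : {P : Ideal B | (⊥ : Ideal B).IsAssociatedPrime P ∧ x ∈ P}.Finite :=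
        (associatedPrimes.finite B B).subset fun P hP => hP.1
      obtain ⟨P, hP, hle⟩ := (Ideal.subset_union_prime_finite hfin (f := fun I : Ideal B => I)
        ⊥ ⊥ (fun P hP _ _ => hP.1.1)).1 (show (N : Set B) ⊆ _ from fun b hbN => by
          obtain ⟨P, hP, hxP, hbP⟩ := hcon b hbN
          exact Set.mem_biUnion (show P ∈ {P : Ideal B | _} from ⟨hP, hxP⟩) hbP)
      exact hNP P hP.1 hP.2 hle
    rw [hNmem] at hbN
    have hc : x + b ∈ nonZeroDivisors B := by
      by_contra hc
      have : x + b ∈ (⋃ P ∈ associatedPrimes B B, (P : Set B)) := by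
        rw [biUnion_associatedPrimes_eq_compl_nonZeroDivisors]; exact hc
      obtain ⟨P, hP, hcP⟩ := Set.mem_iUnion₂.1 this
      replace hP : (⊥ : Ideal B).IsAssociatedPrime P := hP
      have hPp := hP.1
      rcases hPp.mem_or_mem (show x * b ∈ P by rw [hbN]; exact P.zero_mem) with h | h
      · exact hb P hP h ((P.add_mem_iff_right h).1 hcP)
      · have hx := (P.add_mem_iff_left h).1 hcP
        exact hb P hP hx h
    have hxc : x ∈ Ideal.span {x + b} := by
      refine Ideal.mem_of_forall_isAssociatedPrime fun P hP => ?_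
      have hPp := hP.1
      have := h1 _ hc P hP
      have h2 : algebraMap B (Localization.AtPrime P) x * algebraMap B _ b = 0 := by
        rw [← map_mul, hbN, map_zero]
      rcases mul_eq_zero.1 h2 with h | h
      · exact exists_mul_mem_span_singleton P (y := 0) (by rw [h, mul_zero])
      · exact exists_mul_mem_span_singleton P (y := 1) (by rw [map_add, h, mul_one, add_zero])
    obtain ⟨e, he⟩ := Ideal.mem_span_singleton.1 hxc
    have he2 : e * (1 - e) = 0 := by
      have h2 : (e * (1 - e)) * (x + b) * (x + b) = 0 := by
        have h3 : x * x = (x + b) * x := by linear_combination -hbN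
        have h4 : (e * (1 - e)) * (x + b) * (x + b) =
          ((x + b) * e) * (x + b) - ((x + b) * e) * ((x + b) * e) := by ring
        rw [h4, ← he, h3]; ring
      exact (mem_nonZeroDivisors_iff_right.1 hc) _ ((mem_nonZeroDivisors_iff_right.1 hc) _ h2)
    rcases IsLocalRing.isUnit_or_isUnit_one_sub_self e with hu | hu
    · have h1e : 1 - e = 0 := (hu.mul_right_eq_zero).1 he2
      have he1 : e = 1 := by linear_combination -h1e
      rw [he1, mul_one] at he
      rw [← he] at hc
      exact hy ((mem_nonZeroDivisors_iff.1 hc).1 _ hxy)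
    · have he0 : e = 0 := (hu.mul_left_eq_zero).1 he2
      exact hx (by rw [he, he0, mul_zero])
  exact NoZeroDivisors.to_isDomain B

lemma exists_algebraMap_eq_mul_of_isIntegral_div {B L : Type*} [CommRing B] [IsDomain B]
    [CommRing L] [IsDomain L] [IsIntegrallyClosed L] [Algebra B L]
    (hinj : Function.Injective (algebraMap B L)) {a c : B} (hc : c ≠ 0)
    (h : IsIntegral B (algebraMap B (FractionRing B) a / algebraMap B (FractionRing B) c)) :
    ∃ y : L, algebraMap B L a = algebraMap B L c * y := by
  have hinj' : Function.Injective ((algebraMap L (FractionRing L)).comp (algebraMap B L)) :=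
    (IsFractionRing.injective L (FractionRing L)).comp hinj
  let φ : FractionRing B →+* FractionRing L := IsFractionRing.lift hinj'
  have hφ : ∀ b, φ (algebraMap B _ b) = algebraMap L _ (algebraMap B L b) :=
    IsFractionRing.lift_algebraMap hinj'
  have hint := h.map_of_comp_eq (algebraMap B L) φ (RingHom.ext fun b => (hφ b).symm)
  obtain ⟨y, hy⟩ := (isIntegrallyClosed_iff (FractionRing L)).1 ‹_› hint
  refine ⟨y, IsFractionRing.injective L (FractionRing L) ?_⟩
  rw [map_mul, hy, map_div₀, hφ, hφ, mul_div_cancel₀]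
  exact (map_ne_zero_iff _ hinj').2 hc

lemma isIntegrallyClosed_of_isAssociatedPrime {B : Type*} [CommRing B] [IsNoetherianRing B]
    [IsDomain B]
    (h1 : ∀ c : B, c ≠ 0 → ∀ (P : Ideal B) [P.IsPrime], (Ideal.span {c}).IsAssociatedPrime P →
      IsIntegrallyClosed (Localization.AtPrime P)) :
    IsIntegrallyClosed B := by
  rw [isIntegrallyClosed_iff (FractionRing B)]
  intro x hx
  obtain ⟨a, c, hc, rfl⟩ := IsFractionRing.div_surjective (A := B) x
  have hc0 : c ≠ 0 := nonZeroDivisors.ne_zero hc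
  have hcK : algebraMap B (FractionRing B) c ≠ 0 := by simpa using hc0
  suffices ha : a ∈ Ideal.span {c} by
    obtain ⟨y, rfl⟩ := Ideal.mem_span_singleton.1 ha
    exact ⟨y, by rw [map_mul]; field_simp⟩
  refine Ideal.mem_of_forall_isAssociatedPrime fun P hP => ?_
  have hPp := hP.1
  have := h1 c hc0 P hP
  have : IsDomain (Localization.AtPrime P) :=
    IsLocalization.isDomain_localization P.primeCompl_le_nonZeroDivisors
  obtain ⟨y, hy⟩ := exists_algebraMap_eq_mul_of_isIntegral_div (L := Localization.AtPrime P)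
    (IsLocalization.injective _ P.primeCompl_le_nonZeroDivisors) hc0 hx
  exact exists_mul_mem_span_singleton P hy

lemma IsRegularLocalRing.isIntegrallyClosed_of_ringKrullDim_le_one {S : Type*} [CommRing S]
    [IsRegularLocalRing S] (h : ringKrullDim S ≤ 1) : IsDomain S ∧ IsIntegrallyClosed S := by
  have hfin := IsRegularLocalRing.spanFinrank_maximalIdeal (R := S)
  have hdom := (IsRegularLocalRing.isDomain_and_exists_isWeaklyRegular _ S hfin.symm).1
  refine ⟨hdom, ?_⟩
  have h1 : (maximalIdeal S).spanFinrank ≤ 1 := by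
    rw [← hfin] at h
    exact_mod_cast h
  have hp : (maximalIdeal S).IsPrincipal := by
    rcases Nat.le_one_iff_eq_zero_or_eq_one.1 h1 with h0 | h1
    · rw [Submodule.spanFinrank_eq_zero_iff_eq_bot (IsNoetherian.noetherian _)] at h0
      rw [h0]
      infer_instance
    · exact ((Submodule.spanFinrank_eq_one_iff _).1 h1).1
  have := ((tfae_of_isNoetherianRing_of_isLocalRing_of_isDomain S).out 4 0).1 hp
  have : IsPrincipalIdealRing S := this
  infer_instance

lemma isDomain_and_isIntegrallyClosed_localization {A : Type*} [CommRing A] [IsNoetherianRing A]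
    (h : ∀ (q : Ideal A) [q.IsPrime],
      (IsDomain (Localization.AtPrime q) ∧ IsIntegrallyClosed (Localization.AtPrime q)) ∨
      (¬ (⊥ : Ideal (Localization.AtPrime q)).IsAssociatedPrime (maximalIdeal _) ∧
        ∀ c ∈ nonZeroDivisors (Localization.AtPrime q),
          ¬ (Ideal.span {c}).IsAssociatedPrime (maximalIdeal (Localization.AtPrime q))))
    (q : Ideal A) [hq : q.IsPrime] :
    IsDomain (Localization.AtPrime q) ∧ IsIntegrallyClosed (Localization.AtPrime q) := by
  generalize hm : q.height = m
  induction m using WellFoundedLT.induction generalizing q with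
  | ind m ih =>
  obtain h | ⟨h0, h1⟩ := h q
  · exact h
  set B := Localization.AtPrime q
  have key : ∀ (P : Ideal B) [P.IsPrime], P ≠ maximalIdeal B →
      IsDomain (Localization.AtPrime P) ∧ IsIntegrallyClosed (Localization.AtPrime P) := by
    intro P _ hne
    have hlt : P.comap (algebraMap A B) < q := by
      refine lt_of_le_of_ne ?_ fun heq => hne ?_
      · exact (Ideal.comap_mono (IsLocalRing.le_maximalIdeal_of_isPrime P)).trans
          Localization.AtPrime.under_maximalIdeal.le
      · refine (IsLocalization.map_under q.primeCompl B P).symm.trans ?_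
        rw [← Localization.AtPrime.map_eq_maximalIdeal]
        exact congrArg _ heq
    obtain ⟨h2, h3⟩ := ih _ (by rw [← hm]; exact Ideal.height_strict_mono_of_isPrime hlt)
      (P.comap (algebraMap A B)) rfl
    let e := IsLocalization.localizationLocalizationAtPrimeIsoLocalization q.primeCompl P
    exact ⟨MulEquiv.isDomain _ e.toRingEquiv.symm.toMulEquiv,
      IsIntegrallyClosed.of_equiv e.toRingEquiv⟩
  have hdom : IsDomain B := IsLocalRing.isDomain_of_isAssociatedPrime
    (fun P _ hP => (key P fun h => h0 (h ▸ hP)).1)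
    fun c hc P _ hP => (key P fun h => h1 c hc (h ▸ hP)).1
  exact ⟨hdom, isIntegrallyClosed_of_isAssociatedPrime fun c hc P _ hP =>
    (key P fun h => h1 c (mem_nonZeroDivisors_of_ne_zero hc) (h ▸ hP)).2⟩

lemma IsRegularRing.height_le_length_of_isAssociatedPrime {R : Type*} [CommRing R]
    [IsRegularRing R] {rs : List R} (hrs : RingTheory.Sequence.IsWeaklyRegular R rs) {P : Ideal R}
    (hP : (Ideal.ofList rs).IsAssociatedPrime P) : P.height ≤ rs.length := by
  have hprime := hP.1
  obtain ⟨b, hb⟩ := hP.exists_mem_iff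
  by_contra! hlt
  let S := Localization.AtPrime P
  have hrs' := RingTheory.Sequence.IsWeaklyRegular.of_isLocalization S P.primeCompl hrs
  obtain ⟨x, hx, hreg⟩ := IsRegularLocalRing.exists_isSMulRegular_of_length_lt hrs' (by
    rw [IsLocalization.AtPrime.ringKrullDim_eq_height P, List.length_map]
    exact_mod_cast hlt)
  rw [← Ideal.map_ofList] at hreg
  have hmul : maximalIdeal S ≤
      Submodule.colon (Ideal.map (algebraMap R S) (Ideal.ofList rs)) {algebraMap R S b} := by
    rw [← Localization.AtPrime.map_eq_maximalIdeal, Ideal.map_le_iff_le_comap]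
    intro r hr
    rw [Ideal.mem_comap, Submodule.mem_colon_singleton, smul_eq_mul, ← map_mul]
    exact Ideal.mem_map_of_mem _ ((hb r).1 hr)
  have hbI := hreg _ (Submodule.mem_colon_singleton.1 (hmul hx))
  rw [IsLocalization.algebraMap_mem_map_algebraMap_iff P.primeCompl] at hbI
  obtain ⟨u, hu, hub⟩ := hbI
  exact hu ((hb u).2 hub)

lemma IsRegularRing.isWeaklyRegular_of_prefix_height {R : Type*} [CommRing R] [IsRegularRing R]
    (rs : List R) (h : ∀ ts, ts <+: rs → ∀ P : Ideal R, P.IsPrime → Ideal.ofList ts ≤ P →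
      (ts.length : ℕ∞) ≤ P.height) : RingTheory.Sequence.IsWeaklyRegular R rs := by
  induction rs using List.reverseRecOn with
  | nil => exact .nil R R
  | append_singleton rs r ih =>
    have hrs := ih fun ts hts => h ts (hts.trans (List.prefix_append _ _))
    rw [RingTheory.Sequence.isWeaklyRegular_append_iff,
      RingTheory.Sequence.isWeaklyRegular_singleton_iff]
    refine ⟨hrs, ?_⟩
    rw [smul_eq_mul, Ideal.mul_top, isSMulRegular_iff_right_eq_zero_of_smul]
    intro a
    obtain ⟨a, rfl⟩ := Submodule.Quotient.mk_surjective _ a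
    rw [← Submodule.Quotient.mk_smul, Submodule.Quotient.mk_eq_zero, Submodule.Quotient.mk_eq_zero]
    intro ha
    by_contra ha'
    obtain ⟨P, hP, hle⟩ := Ideal.exists_isAssociatedPrime_of_notMem ha'
    have h1 := IsRegularRing.height_le_length_of_isAssociatedPrime hrs hP
    obtain ⟨b, hb⟩ := hP.exists_mem_iff
    have h2 := h _ (List.prefix_refl _) P hP.1 (by
      rw [Ideal.ofList_append, Ideal.ofList_singleton, sup_le_iff, Ideal.span_singleton_le_iff_mem]
      exact ⟨fun r hr => (hb r).2 (Ideal.mul_mem_right _ _ hr), hle r ha⟩)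
    have h3 := h2.trans h1
    rw [List.length_append, List.length_singleton] at h3
    have : rs.length + 1 ≤ rs.length := by exact_mod_cast h3
    omega

lemma IsRegularLocalRing.not_isAssociatedPrime_maximalIdeal {S B : Type*} [CommRing S]
    [IsRegularLocalRing S] [CommRing B] [IsLocalRing B] [IsNoetherianRing B]
    {π : S →+* B} (hπ : Function.Surjective π)
    {J : Ideal B} {rs : List S} (hrs : RingTheory.Sequence.IsWeaklyRegular S rs)
    (hJ : J.comap π = Ideal.ofList rs) (hlt : (rs.length : WithBot ℕ∞) < ringKrullDim S) :
    ¬ J.IsAssociatedPrime (maximalIdeal B) := by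
  intro hP
  obtain ⟨b, hb⟩ := hP.exists_mem_iff
  obtain ⟨b, rfl⟩ := hπ b
  obtain ⟨x, hx, hreg⟩ := IsRegularLocalRing.exists_isSMulRegular_of_length_lt hrs hlt
  have hπx : π x ∈ maximalIdeal B := by
    have := IsLocalHom.of_surjective π hπ
    exact map_nonunit π x hx
  have h1 := hreg b (by rw [← hJ, Ideal.mem_comap, map_mul]; exact (hb _).1 hπx)
  rw [← hJ, Ideal.mem_comap] at h1
  exact (maximalIdeal.isMaximal B).ne_top ((Ideal.eq_top_iff_one _).2 ((hb 1).2 (by simpa using h1)))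

lemma Localization.ker_localRingHom_of_surjective {R A : Type*} [CommRing R] [CommRing A]
    (φ : R →+* A) (hφ : Function.Surjective φ) (q : Ideal A) [q.IsPrime] :
    RingHom.ker (Localization.localRingHom (q.comap φ) q φ rfl) =
      (RingHom.ker φ).map (algebraMap R (Localization.AtPrime (q.comap φ))) := by
  refine le_antisymm (fun x hx => ?_) ?_
  · obtain ⟨r, t, rfl⟩ := IsLocalization.exists_mk'_eq (q.comap φ).primeCompl x
    rw [RingHom.mem_ker, Localization.localRingHom_mk', IsLocalization.mk'_eq_zero_iff] at hx
    obtain ⟨⟨m, hm⟩, hmr⟩ := hx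
    obtain ⟨u, rfl⟩ := hφ m
    rw [IsLocalization.mk'_mem_map_algebraMap_iff]
    exact ⟨u, hm, by rw [RingHom.mem_ker, map_mul]; exact hmr⟩
  · rw [Ideal.map_le_iff_le_comap]
    intro r hr
    rw [Ideal.mem_comap, RingHom.mem_ker, Localization.localRingHom_to_map, hr, map_zero]

lemma IsRegularLocalRing.isIntegrallyClosed_of_ker_eq_span {S B : Type*} [CommRing S]
    [IsRegularLocalRing S] [CommRing B] {π : S →+* B} (hπ : Function.Surjective π) {m : ℕ}
    (g : Fin m → maximalIdeal S)
    (hg : LinearIndependent (ResidueField S) fun i => (maximalIdeal S).toCotangent (g i))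
    (hker : RingHom.ker π = Ideal.span (Set.range fun i => (g i : S)))
    (hle : Module.finrank (ResidueField S) (CotangentSpace S) ≤ m + 1) :
    IsDomain B ∧ IsIntegrallyClosed B := by
  have h1 := hg.fintype_card_le_finrank
  rw [Fintype.card_fin] at h1
  obtain ⟨e, he⟩ := Nat.exists_eq_add_of_le h1
  obtain ⟨hreg, hdim⟩ := IsRegularLocalRing.quotient_span_range he g hg
  rw [← hker] at hreg hdim
  let E := RingHom.quotientKerEquivOfSurjective hπ
  have : IsRegularLocalRing B := .of_ringEquiv E
  refine IsRegularLocalRing.isIntegrallyClosed_of_ringKrullDim_le_one ?_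
  rw [← ringKrullDim_eq_of_ringEquiv E, hdim]
  have : e ≤ 1 := Nat.le_of_add_le_add_left (he.symm.trans_le hle)
  exact_mod_cast this

section Normality
variable {k : Type} [Field k] [IsAlgClosed k] {n : ℕ}

lemma isWeaklyRegular_ofFn_of_lt_polySchmidtRank {d s : ℕ} (hd : 1 ≤ d)
    {f : Fin s → MvPolynomial (Fin n) k} (hhom : ∀ i, (f i).IsHomogeneous d)
    (hrank : ∀ c : Fin s → k, c ≠ 0 → (s - 1) * (d - 1) < polySchmidtRank (∑ i, c i • f i)) :
    RingTheory.Sequence.IsWeaklyRegular (MvPolynomial (Fin n) k) (List.ofFn f) := by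
  refine IsRegularRing.isWeaklyRegular_of_prefix_height _ fun ts hts P _ hP => ?_
  have hle : ts.length ≤ s := by simpa using hts.length_le
  have hget : ∀ i : Fin ts.length, ts[i] = f (Fin.castLE hle i) := fun i => by
    rw [Fin.getElem_fin, hts.getElem]
    simp [Fin.castLE]
  refine le_height_of_lt_polySchmidtRank hd (f := fun i => f (Fin.castLE hle i))
    (fun i => hhom _) (fun c hc => ?_) P fun i => hP ?_
  · have hinj : Function.Injective (Fin.castLE hle) := Fin.castLE_injective hle
    have hsum : ∑ i, c i • f (Fin.castLE hle i) =
        ∑ i, Function.extend (Fin.castLE hle) c 0 i • f i := by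
      refine Fintype.sum_of_injective _ hinj _ _ (fun i hi => ?_) fun i => ?_
      · rw [Function.extend_apply' _ _ _ hi, Pi.zero_apply, zero_smul]
      · rw [hinj.extend_apply]
    rw [hsum]
    refine lt_of_le_of_lt (Nat.mul_le_mul_right _ (Nat.sub_le_sub_right hle 1)) (hrank _ ?_)
    intro h0
    refine hc (funext fun i => ?_)
    rw [← hinj.extend_apply c 0 i, h0]
    rfl
  · rw [← hget]
    exact Ideal.subset_span (List.getElem_mem _)

lemma isNormalZeroLocus_of_lt_polySchmidtRank {d s : ℕ} (hd : 1 ≤ d)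
    {f : Fin s → MvPolynomial (Fin n) k} (hhom : ∀ i, (f i).IsHomogeneous d)
    (hrank : ∀ c : Fin s → k, c ≠ 0 → (s + 1) * (d - 1) < polySchmidtRank (∑ i, c i • f i)) :
    IsNormalZeroLocus (Ideal.span (Set.range f)) := by
  have hreg := isWeaklyRegular_ofFn_of_lt_polySchmidtRank hd hhom fun c hc =>
    lt_of_le_of_lt (Nat.mul_le_mul_right _ (by omega)) (hrank c hc)
  set I := Ideal.span (Set.range f) with hI
  have hIf : Ideal.ofList (List.ofFn f) = I := by
    rw [hI, Ideal.ofList]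
    congr 1
    ext
    simp
  have hmap : ∀ {T : Type} [CommRing T] (ψ : MvPolynomial (Fin n) k →+* T),
      I.map ψ = Ideal.span (Set.range fun i => ψ (f i)) := fun ψ => by
    rw [hI, Ideal.map_span, ← Set.range_comp']
  refine fun q => isDomain_and_isIntegrallyClosed_localization (fun q _ => ?_) q.asIdeal
  let φ := Ideal.Quotient.mk I
  have hφ : Function.Surjective φ := Ideal.Quotient.mk_surjective
  let Q := q.comap φ
  let S := Localization.AtPrime Q
  let B := Localization.AtPrime q
  have hfQ : ∀ i, f i ∈ Q := fun i => by
    have h0 : φ (f i) = 0 := Ideal.Quotient.eq_zero_iff_mem.2 (Ideal.subset_span ⟨i, rfl⟩)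
    rw [Ideal.mem_comap, h0]
    exact q.zero_mem
  let π : S →+* B := Localization.localRingHom Q q φ rfl
  have hπ : Function.Surjective π := RingHom.surjective_localRingHom_of_surjective φ hφ q
  have hker : RingHom.ker π = I.map (algebraMap _ S) := by
    rw [Localization.ker_localRingHom_of_surjective φ hφ q, Ideal.mk_ker]
  by_cases hQ : Q.height ≤ (s + 1 : ℕ)
  · left
    have hLI := (linearIndependent_cotangentClass_iff Q fun i => ⟨f i, hfQ i⟩).2
      (linearIndependent_residueGradient_of_height_le hd hhom hrank Q hfQ hQ)
    have hfin := finrank_cotangentSpace_eq_height Q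
    rw [← hfin] at hQ
    refine IsRegularLocalRing.isIntegrallyClosed_of_ker_eq_span hπ (fun i =>
      ⟨algebraMap _ S (f i), (IsLocalization.AtPrime.to_map_mem_maximal_iff S Q _).2 (hfQ i)⟩) hLI ?_
      (by exact_mod_cast hQ)
    rw [hker, hmap]
  · right
    have hdim : ((s + 1 : ℕ) : WithBot ℕ∞) < ringKrullDim S := by
      rw [IsLocalization.AtPrime.ringKrullDim_eq_height Q]
      exact_mod_cast not_le.1 hQ
    have hregS := RingTheory.Sequence.IsWeaklyRegular.of_isLocalization S Q.primeCompl hreg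
    set rs := (List.ofFn f).map (algebraMap _ S) with hrs
    have hlen : rs.length = s := by simp [hrs]
    have hker' : RingHom.ker π = Ideal.ofList rs := by rw [hker, hrs, ← Ideal.map_ofList, hIf]
    refine ⟨IsRegularLocalRing.not_isAssociatedPrime_maximalIdeal hπ hregS hker' ?_, fun c hc => ?_⟩
    · rw [hlen]
      exact lt_trans (by exact_mod_cast Nat.lt_succ_self s) hdim
    · obtain ⟨c, rfl⟩ := hπ c
      refine IsRegularLocalRing.not_isAssociatedPrime_maximalIdeal hπ (rs := rs ++ [c]) ?_ ?_ ?_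
      · rw [RingTheory.Sequence.isWeaklyRegular_append_iff,
          RingTheory.Sequence.isWeaklyRegular_singleton_iff]
        refine ⟨hregS, ?_⟩
        rw [smul_eq_mul, Ideal.mul_top, isSMulRegular_iff_right_eq_zero_of_smul]
        intro a
        obtain ⟨a, rfl⟩ := Submodule.Quotient.mk_surjective _ a
        rw [← Submodule.Quotient.mk_smul, Submodule.Quotient.mk_eq_zero,
          Submodule.Quotient.mk_eq_zero, ← hker', RingHom.mem_ker, RingHom.mem_ker, smul_eq_mul,
          map_mul]
        exact (mul_right_mem_nonZeroDivisors_eq_zero_iff hc).1 ∘ (mul_comm _ _).trans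
      · rw [Ideal.ofList_append, Ideal.ofList_singleton, ← hker', ← Set.image_singleton,
          ← Ideal.map_span, Ideal.comap_map_of_surjective' _ hπ, sup_comm]
      · rw [List.length_append, hlen]
        exact hdim

end Normality

lemma lt_polySchmidtRank_of_lt_polySchmidtRankFamily {k : Type} [Field k] {σ : Type} {N s : ℕ}
    {f : Fin s → MvPolynomial σ k} (h : N < polySchmidtRankFamily f) (c : Fin s → k) (hc : c ≠ 0) :
    N < polySchmidtRank (∑ i, c i • f i) :=
  h.trans_le (Nat.sInf_le ⟨c, hc, rfl⟩)

end

lemma affineCodim_eq_of_mul_le_polySchmidtRankFamily {k : Type} [Field k] [IsAlgClosed k]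
    {n d s N : ℕ} (hd : 1 ≤ d) (hN : d ≤ N) {f : Fin s → MvPolynomial (Fin n) k}
    (hhom : ∀ i, (f i).IsHomogeneous d) (h : N * (2 * s - 1) ≤ polySchmidtRankFamily f) :
    affineCodim k (Ideal.span (Set.range f)) = (s : ℕ∞) := by
  refine affineCodim_eq_of_lt_polySchmidtRank hd hhom fun c hc =>
    lt_polySchmidtRank_of_lt_polySchmidtRankFamily (lt_of_lt_of_le ?_ h) c hc
  obtain ⟨i, -⟩ := Function.ne_iff.1 hc
  have hs : s - 1 < 2 * s - 1 := by have := i.pos; omega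
  exact lt_of_lt_of_le (by rw [mul_comm]; exact Nat.mul_lt_mul_of_lt_of_le (by omega) hs.le (by omega))
    (Nat.mul_le_mul_right _ hN)

lemma isNormalZeroLocus_of_mul_le_polySchmidtRankFamily {k : Type} [Field k] [IsAlgClosed k]
    {n d s N : ℕ} (hd : 1 ≤ d) (hN : d ≤ N) {f : Fin s → MvPolynomial (Fin n) k}
    (hhom : ∀ i, (f i).IsHomogeneous d) (h : N * (2 * s + 1) ≤ polySchmidtRankFamily f) :
    IsNormalZeroLocus (Ideal.span (Set.range f)) := by
  refine isNormalZeroLocus_of_lt_polySchmidtRank hd hhom fun c hc =>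
    lt_polySchmidtRank_of_lt_polySchmidtRankFamily (lt_of_lt_of_le ?_ h) c hc
  obtain ⟨i, -⟩ := Function.ne_iff.1 hc
  have hs : s + 1 ≤ 2 * s + 1 := by omega
  exact lt_of_lt_of_le (by rw [mul_comm]; exact Nat.mul_lt_mul_of_lt_of_le (by omega) hs (by omega))
    (Nat.mul_le_mul_right _ hN)

/-- Theorem 1.5(iii). Let `k` be algebraically closed with
`char k ∤ d(d-1)`, `d ≥ 3`, and `f̄ = (f 1, …, f s)` a collection of homogeneous polynomials
of degree `d` on `V`.  If `rk^S(f̄) ≥ 2^{d-3}·(d+1)·(2s-1)` (resp.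
`rk^S(f̄) ≥ 2^{d-3}·d·(2s-1)` if `d` is odd) then `(f 1, …, f s)` define a complete
intersection `V(f̄)` of codimension `s` in `V`.  If moreover
`rk^S(f̄) ≥ 2^{d-3}·(d+1)·(2s+1)` (resp. `rk^S(f̄) ≥ 2^{d-3}·d·(2s+1)` if `d` is odd) then
`V(f̄)` is normal. -/
theorem complete_intersection_and_normal_of_large_rank {k : Type} [Field k] [IsAlgClosed k]
    {n d s : ℕ} (hd : 3 ≤ d) (hchar : ¬ (ringChar k ∣ d * (d - 1)))
    (f : Fin s → MvPolynomial (Fin n) k) (hhom : ∀ i, (f i).IsHomogeneous d) :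
    (2 ^ (d - 3) * (d + 1) * (2 * s - 1) ≤ polySchmidtRankFamily f →
        affineCodim k (Ideal.span (Set.range f)) = (s : ℕ∞)) ∧
      (Odd d → 2 ^ (d - 3) * d * (2 * s - 1) ≤ polySchmidtRankFamily f →
        affineCodim k (Ideal.span (Set.range f)) = (s : ℕ∞)) ∧
      (2 ^ (d - 3) * (d + 1) * (2 * s + 1) ≤ polySchmidtRankFamily f →
        IsNormalZeroLocus (Ideal.span (Set.range f))) ∧
      (Odd d → 2 ^ (d - 3) * d * (2 * s + 1) ≤ polySchmidtRankFamily f →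
        IsNormalZeroLocus (Ideal.span (Set.range f))) := by
  have h1 : d ≤ 2 ^ (d - 3) * (d + 1) :=
    (Nat.le_succ d).trans (Nat.le_mul_of_pos_left _ (by positivity))
  have h2 : d ≤ 2 ^ (d - 3) * d := Nat.le_mul_of_pos_left _ (by positivity)
  have hd1 : 1 ≤ d := by omega
  exact ⟨affineCodim_eq_of_mul_le_polySchmidtRankFamily hd1 h1 hhom,
    fun _ => affineCodim_eq_of_mul_le_polySchmidtRankFamily hd1 h2 hhom,
    isNormalZeroLocus_of_mul_le_polySchmidtRankFamily hd1 h1 hhom,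
    fun _ => isNormalZeroLocus_of_mul_le_polySchmidtRankFamily hd1 h2 hhom⟩
end
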